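/- Let X be a Cantor space and K a divisible dynamical simplex on X. Then there exist a homeomorphism φ of X and a Toeplitz sequence y ∈ {0,1}^ℤ such that (X, φ) is topologically conjugate to the Toeplitz subshift associated to y (i.e., there is a homeomorphism h from X onto the closure of the S-orbit of y with h ∘ φ = S ∘ h), and K = {μ ∈ Prob(X) : φ_*μ = μ}. -/

import Mathlib

open MeasureTheory Set
open scoped ENNReal NNReal

/-- `K` is a dynamical simplex: nonempty, compact, convex, all its elements are atomless
with full support, and it has the Glasner–Weiss property. -/
def IsDynSimplex {X : Type*} [TopologicalSpace X] [MeasurableSpace X] [OpensMeasurableSpace X]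
    (K : Set (ProbabilityMeasure X)) : Prop :=
  K.Nonempty ∧ IsCompact K ∧
    (∀ μ ∈ K, ∀ ν ∈ K, ∀ t : ℝ≥0∞, t ≤ 1 →
      ∃ σ ∈ K, (σ : Measure X) = t • (μ : Measure X) + (1 - t) • (ν : Measure X)) ∧
    (∀ μ ∈ K, NoAtoms (μ : Measure X)) ∧
    (∀ μ ∈ K, (μ : Measure X).IsOpenPosMeasure) ∧
    (∀ U V : Set X, IsClopen U → IsClopen V →
      (∀ μ ∈ K, (μ : Measure X) U < (μ : Measure X) V) →
      ∃ W : Set X, IsClopen W ∧ W ⊆ V ∧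
        ∀ μ ∈ K, (μ : Measure X) W = (μ : Measure X) U)

/-- `K` is divisible: for every clopen `U` and every `n ≥ 1` there is a clopen `V ⊆ U`
of measure `μ(U)/n` for every `μ ∈ K`. -/
def Divisible {X : Type*} [TopologicalSpace X] [MeasurableSpace X]
    (K : Set (ProbabilityMeasure X)) : Prop :=
  ∀ U : Set X, IsClopen U → ∀ n : ℕ, 1 ≤ n →
    ∃ V : Set X, IsClopen V ∧ V ⊆ U ∧
      ∀ μ ∈ K, (μ : Measure X) V = (μ : Measure X) U / n

/-- The `k`-th power of the shift map on `ℤ → A`: `shiftBy k x n = x (n + k)`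
(`shiftBy 1` is the shift `S`, with `S x n = x (n + 1)`). -/
def shiftBy {A : Type*} (k : ℤ) (x : ℤ → A) : ℤ → A := fun n => x (n + k)

/-- `x` is quasiperiodic: every position occurs periodically. -/
def Quasiperiodic {A : Type*} (x : ℤ → A) : Prop :=
  ∀ m : ℤ, ∃ p : ℤ, p ≠ 0 ∧ ∀ n : ℤ, x m = x (m + n * p)

/-- `x` is periodic. -/
def IsPeriodic {A : Type*} (x : ℤ → A) : Prop :=
  ∃ p : ℤ, p ≠ 0 ∧ ∀ m : ℤ, x (m + p) = x m

/-- `x` is a Toeplitz sequence: quasiperiodic but not periodic. -/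
def IsToeplitz {A : Type*} (x : ℤ → A) : Prop :=
  Quasiperiodic x ∧ ¬ IsPeriodic x

/-- The underlying space of the Toeplitz subshift associated to `x`: the closure of the
orbit of `x` under the shift (in the product topology). -/
def orbitClosure {A : Type*} [TopologicalSpace A] (x : ℤ → A) : Set (ℤ → A) :=
  closure {y : ℤ → A | ∃ k : ℤ, y = shiftBy k x}

namespace ToeplitzProof

/-- the rational span of the evaluation functions of clopen sets -/
noncomputable def EE {X I : Type*} [TopologicalSpace X] (ev : Set X → I → ℝ) : Submodule ℚ (I → ℝ) :=
  Submodule.span ℚ (ev '' {U | IsClopen U})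

/-- abstract version of a divisible dynamical simplex -/
structure EvSys {X I : Type*} [TopologicalSpace X] (ev : Set X → I → ℝ) : Prop where
  add : ∀ U V, IsClopen U → IsClopen V → Disjoint U V → ev (U ∪ V) = ev U + ev V
  univ : ev Set.univ = 1
  pos : ∀ U, IsClopen U → U.Nonempty → ∀ i, 0 < ev U i
  gw : ∀ U V, IsClopen U → IsClopen V → (∀ i, ev U i < ev V i) →
    ∃ W, IsClopen W ∧ W ⊆ V ∧ ev W = ev U
  div : ∀ U, IsClopen U → ∀ n : ℕ, 1 ≤ n → ∃ V, IsClopen V ∧ V ⊆ U ∧ ∀ i, ev V i = ev U i / n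
  bdd : ∀ g ∈ EE ev, (∀ i, 0 < g i) → ∃ N : ℕ, 0 < N ∧ ∀ i, 1 < N * g i
  ne : Nonempty I

/-- the positive cone -/
def MM {X I : Type*} [TopologicalSpace X] (ev : Set X → I → ℝ) (g : I → ℝ) : Prop :=
  g ∈ EE ev ∧ (g = 0 ∨ ∀ i, 0 < g i)

section
variable {X I : Type*} [TopologicalSpace X] {ev : Set X → I → ℝ}

theorem MM.zero : MM ev 0 := ⟨Submodule.zero_mem _, Or.inl rfl⟩

theorem MM.add {g h : I → ℝ} (hg : MM ev g) (hh : MM ev h) : MM ev (g + h) := by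
  refine ⟨Submodule.add_mem _ hg.1 hh.1, ?_⟩
  rcases hg.2 with rfl | h1
  · simpa using hh.2
  · rcases hh.2 with rfl | h2
    · right; simpa using h1
    · right; intro i; have := h1 i; have := h2 i; simp; linarith

theorem MM.sum {ι : Type*} (s : Finset ι) (g : ι → I → ℝ) (hg : ∀ i ∈ s, MM ev (g i)) :
    MM ev (∑ i ∈ s, g i) := by
  classical
  induction s using Finset.induction_on with
  | empty => simpa using MM.zero
  | insert a s ha ih =>
    rw [Finset.sum_insert ha]
    exact (hg a (by simp)).add (ih fun i hi => hg i (by simp [hi]))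

theorem MM.smul {g : I → ℝ} (hg : MM ev g) (r : ℚ) (hr : 0 ≤ r) : MM ev (r • g) := by
  refine ⟨Submodule.smul_mem _ r hg.1, ?_⟩
  rcases hr.eq_or_lt with rfl | hr
  · left; simp
  rcases hg.2 with rfl | h1
  · left; simp
  · right; intro i
    have := h1 i
    have hr' : (0:ℝ) < r := by exact_mod_cast hr
    rw [Pi.smul_apply, Rat.smul_def]; positivity

theorem MM.nonneg {g : I → ℝ} (hg : MM ev g) (i : I) : 0 ≤ g i := by
  rcases hg.2 with rfl | h1
  · simp
  · exact (h1 i).le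

theorem EE.ev_mem {U : Set X} (hU : IsClopen U) : ev U ∈ EE ev :=
  Submodule.subset_span ⟨U, hU, rfl⟩

theorem EvSys.empty (S : EvSys ev) : ev ∅ = 0 := by
  have := S.add ∅ ∅ isClopen_empty isClopen_empty (by simp)
  simpa using this

theorem EvSys.MM_ev (S : EvSys ev) {U : Set X} (hU : IsClopen U) : MM ev (ev U) := by
  refine ⟨EE.ev_mem hU, ?_⟩
  rcases U.eq_empty_or_nonempty with rfl | h
  · left; exact S.empty
  · right; exact S.pos U hU h

theorem EvSys.diff (S : EvSys ev) {U V : Set X} (hU : IsClopen U) (hV : IsClopen V) (h : U ⊆ V) :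
    ev (V \ U) = ev V - ev U := by
  have := S.add U (V \ U) hU (hV.diff hU) disjoint_sdiff_self_right
  rw [Set.union_sdiff_cancel h] at this
  rw [this]; abel

theorem EvSys.list_realize (S : EvSys ev) (l : List (Set X)) (hl : ∀ U ∈ l, IsClopen U)
    (n : ℕ) (hn : 1 ≤ n) : ∀ V : Set X, IsClopen V →
    (∀ i, (l.map ev).sum i < n * ev V i) →
    ∃ W, IsClopen W ∧ W ⊆ V ∧ ∀ i, (n:ℝ) * ev W i = (l.map ev).sum i := by
  have hn' : (0:ℝ) < n := by exact_mod_cast hn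
  induction l with
  | nil => 
    intro V hV h
    exact ⟨∅, isClopen_empty, by simp, by simp [S.empty]⟩
  | cons U l ih =>
    intro V hV h
    have hU := hl U (by simp)
    have hl' : ∀ U ∈ l, IsClopen U := fun U h => hl U (by simp [h])
    have hnn : ∀ i, 0 ≤ (l.map ev).sum i := by
      intro i
      have : MM ev (l.map ev).sum := by
        clear h ih hl
        induction l with
        | nil => simpa using MM.zero
        | cons a l ih => 
          simp only [List.map_cons, List.sum_cons]
          exact (S.MM_ev (hl' a (by simp))).add (ih fun U h => hl' U (by simp [h]))
      exact this.nonneg i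
    obtain ⟨U', hU', -, hU'2⟩ := S.div U hU n hn
    simp only [List.map_cons, List.sum_cons, Pi.add_apply] at h
    obtain ⟨W1, hW1, hW1V, hW1e⟩ := S.gw U' V hU' hV (by
      intro i
      rw [hU'2 i, div_lt_iff₀ hn']
      have := h i; have := hnn i; linarith)
    obtain ⟨W2, hW2, hW2V, hW2e⟩ := ih hl' (V \ W1) (hV.diff hW1) (by
      intro i
      rw [S.diff hW1 hV hW1V, hW1e, Pi.sub_apply, hU'2 i, mul_sub, mul_div_cancel₀ _ hn'.ne']
      have := h i; linarith)
    refine ⟨W1 ∪ W2, hW1.union hW2, Set.union_subset hW1V (hW2V.trans sdiff_subset), ?_⟩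
    intro i
    rw [S.add W1 W2 hW1 hW2 (Set.disjoint_left.2 fun x h1 h2 => (hW2V h2).2 h1), Pi.add_apply,
      mul_add, hW2e, hW1e, hU'2, mul_div_cancel₀ _ hn'.ne']
    simp

theorem EE.repr {g : I → ℝ} (hg : g ∈ EE ev) : ∃ (n : ℕ) (l l' : List (Set X)), 1 ≤ n ∧
    (∀ U ∈ l, IsClopen U) ∧ (∀ U ∈ l', IsClopen U) ∧
    ∀ i, (n:ℝ) * g i = (l.map ev).sum i - (l'.map ev).sum i := by
  have key : ∀ (m : ℕ) (l : List (Set X)), (∀ U ∈ l, IsClopen U) →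
      ∃ l' : List (Set X), (∀ U ∈ l', IsClopen U) ∧
        ∀ i, (l'.map ev).sum i = m * (l.map ev).sum i := by
    intro m l hl
    induction m with
    | zero => exact ⟨[], by simp, by simp⟩
    | succ m ih =>
      obtain ⟨l', h1, h2⟩ := ih
      refine ⟨l ++ l', ?_, ?_⟩
      · intro U hU; rcases List.mem_append.1 hU with h | h
        · exact hl U h
        · exact h1 U h
      · intro i; simp [h2 i]; ring
  induction hg using Submodule.span_induction with
  | mem x h =>
    obtain ⟨U, hU, rfl⟩ := h
    exact ⟨1, [U], [], le_rfl, by simpa using hU, by simp, by simp⟩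
  | zero => exact ⟨1, [], [], le_rfl, by simp, by simp, by simp⟩
  | add x y _ _ hx hy =>
    obtain ⟨n, l1, l2, hn, h1, h2, h3⟩ := hx
    obtain ⟨n', l1', l2', hn', h1', h2', h3'⟩ := hy
    obtain ⟨k1, hk1, hk1'⟩ := key n' l1 h1
    obtain ⟨k2, hk2, hk2'⟩ := key n' l2 h2
    obtain ⟨k3, hk3, hk3'⟩ := key n l1' h1'
    obtain ⟨k4, hk4, hk4'⟩ := key n l2' h2'
    refine ⟨n * n', k1 ++ k3, k2 ++ k4, Nat.mul_pos hn hn', ?_, ?_, ?_⟩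
    · intro U hU; rcases List.mem_append.1 hU with h | h
      · exact hk1 U h
      · exact hk3 U h
    · intro U hU; rcases List.mem_append.1 hU with h | h
      · exact hk2 U h
      · exact hk4 U h
    · intro i
      have e1 := h3 i
      have e2 := h3' i
      simp only [List.map_append, List.sum_append, Pi.add_apply, hk1', hk2', hk3', hk4']
      push_cast
      linear_combination (n':ℝ) * e1 + (n:ℝ) * e2
  | smul a x _ hx =>
    obtain ⟨n, l1, l2, hn, h1, h2, h3⟩ := hx
    have ha : (a:ℝ) * a.den = a.num := by exact_mod_cast Rat.mul_den_eq_num a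
    obtain ⟨k1, hk1, hk1'⟩ := key a.num.natAbs l1 h1
    obtain ⟨k2, hk2, hk2'⟩ := key a.num.natAbs l2 h2
    rcases le_total 0 a.num with h0 | h0
    · refine ⟨n * a.den, k1, k2, Nat.mul_pos hn a.den_pos, hk1, hk2, ?_⟩
      intro i
      have e1 := h3 i
      have : ((a.num.natAbs : ℕ) : ℝ) = a.num := by
        rw [Nat.cast_natAbs, abs_of_nonneg h0]
      rw [hk1', hk2', this, Pi.smul_apply, Rat.smul_def]
      push_cast
      linear_combination (a.num:ℝ) * e1 + (n:ℝ) * x i * ha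
    · refine ⟨n * a.den, k2, k1, Nat.mul_pos hn a.den_pos, hk2, hk1, ?_⟩
      intro i
      have e1 := h3 i
      have : ((a.num.natAbs : ℕ) : ℝ) = -a.num := by
        rw [Nat.cast_natAbs, abs_of_nonpos h0]; simp
      rw [hk1', hk2', this, Pi.smul_apply, Rat.smul_def]
      push_cast
      linear_combination (a.num:ℝ) * e1 + (n:ℝ) * x i * ha

theorem EvSys.le_one (S : EvSys ev) {U : Set X} (hU : IsClopen U) (i : I) : ev U i ≤ 1 := by
  have h1 := S.diff hU isClopen_univ (subset_univ _)
  have h2 := (S.MM_ev (isClopen_univ.diff hU)).nonneg i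
  rw [h1, S.univ] at h2
  simp at h2; linarith

theorem EvSys.realize (S : EvSys ev) {g : I → ℝ} (hg : g ∈ EE ev) (hpos : ∀ i, 0 < g i)
    {V : Set X} (hV : IsClopen V) (hlt : ∀ i, g i < ev V i) :
    ∃ W, IsClopen W ∧ W ⊆ V ∧ ev W = g := by
  obtain ⟨n, l1, l2, hn, h1, h2, h3⟩ := EE.repr hg
  have hn' : (0:ℝ) < n := by exact_mod_cast hn
  set N := l1.length + 1 with hN
  have hN' : (0:ℝ) < N := by positivity
  have hb : ∀ i, (l1.map ev).sum i ≤ l1.length := by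
    intro i
    clear h3 hN N hN'
    induction l1 with
    | nil => simp
    | cons a l ih =>
      have := ih (fun U h => h1 U (by simp [h]))
      have := S.le_one (h1 a (by simp)) i
      simp; linarith
  obtain ⟨W1, hW1, -, e1⟩ := S.list_realize l1 h1 N (by omega) Set.univ isClopen_univ (by
    intro i; rw [S.univ, hN]; have := hb i; push_cast; simp; linarith)
  obtain ⟨W2, hW2, hW21, e2⟩ := S.list_realize l2 h2 N (by omega) W1 hW1 (by
    intro i; rw [e1]; have := h3 i; have := mul_pos hn' (hpos i); linarith)
  have e3 : ∀ i, (N:ℝ) * ev (W1 \ W2) i = n * g i := by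
    intro i; rw [S.diff hW2 hW1 hW21, Pi.sub_apply, mul_sub, e1, e2, h3]
  have e4 : ∀ i, ((List.replicate N (W1 \ W2)).map ev).sum i = n * g i := by
    intro i; rw [← e3]; simp
  obtain ⟨W, hW, hWV, e⟩ := S.list_realize (List.replicate N (W1 \ W2)) (by
    intro U hU; rw [List.eq_of_mem_replicate hU]; exact hW1.diff hW2) n hn V hV (by
    intro i; rw [e4]; exact mul_lt_mul_of_pos_left (hlt i) hn')
  refine ⟨W, hW, hWV, ?_⟩
  funext i
  have := e i
  rw [e4] at this
  exact mul_left_cancel₀ hn'.ne' this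

theorem EvSys.realize' (S : EvSys ev) {g h : I → ℝ} (hg : MM ev g) (hh : MM ev h)
    {V : Set X} (hV : IsClopen V) (he : g + h = ev V) :
    ∃ W, IsClopen W ∧ W ⊆ V ∧ ev W = g := by
  rcases hg.2 with rfl | h1
  · exact ⟨∅, isClopen_empty, by simp, S.empty⟩
  rcases hh.2 with rfl | h2
  · exact ⟨V, hV, subset_rfl, by simpa using he.symm⟩
  · exact S.realize hg.1 h1 hV (by intro i; rw [← he]; have := h2 i; simp; linarith)

theorem EvSys.eq_empty (S : EvSys ev) {V : Set X} (hV : IsClopen V) (h : ev V = 0) : V = ∅ := by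
  by_contra hne
  obtain ⟨i⟩ := S.ne
  have := S.pos V hV (Set.nonempty_iff_ne_empty.2 hne) i
  rw [h] at this; simp at this

theorem EvSys.partition (S : EvSys ev) {ι : Type*} (s : Finset ι) (g : ι → I → ℝ)
    (hg : ∀ j ∈ s, MM ev (g j)) : ∀ V : Set X, IsClopen V → (∑ j ∈ s, g j = ev V) →
    ∃ W : ι → Set X, (∀ j ∈ s, IsClopen (W j)) ∧ (∀ j ∈ s, ∀ k ∈ s, ∀ x, x ∈ W j → x ∈ W k → j = k) ∧
      (∀ x, x ∈ V ↔ ∃ j ∈ s, x ∈ W j) ∧ ∀ j ∈ s, ev (W j) = g j := by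
  classical
  induction s using Finset.induction_on with
  | empty =>
    intro V hV h
    have : V = ∅ := S.eq_empty hV (by simpa using h.symm)
    exact ⟨fun _ => ∅, by simp, by simp, by simp [this], by simp⟩
  | insert a s ha ih =>
    intro V hV h
    rw [Finset.sum_insert ha] at h
    have hs : ∀ j ∈ s, MM ev (g j) := fun j hj => hg j (by simp [hj])
    obtain ⟨W0, hW0, hW0V, e0⟩ := S.realize' (hg a (by simp)) (MM.sum s g hs) hV h
    obtain ⟨W, h1, h2, h3, h4⟩ := ih hs (V \ W0) (hV.diff hW0) (by
      rw [S.diff hW0 hV hW0V, e0, ← h]; simp)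
    have hne : ∀ j ∈ s, j ≠ a := fun j hj e => ha (e ▸ hj)
    have hd : ∀ j ∈ s, ∀ x, x ∈ W j → x ∉ W0 := fun j hj x hx => ((h3 x).2 ⟨j, hj, hx⟩).2
    refine ⟨fun j => if j = a then W0 else W j, ?_, ?_, ?_, ?_⟩
    · intro j hj
      rcases Finset.mem_insert.1 hj with rfl | hj
      · simpa using hW0
      · simpa [hne j hj] using h1 j hj
    · intro j hj k hk x hxj hxk
      rcases Finset.mem_insert.1 hj with hj | hj <;> rcases Finset.mem_insert.1 hk with hk | hk
      · rw [hj, hk]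
      · simp [hne k hk, hj] at hxj hxk; exact absurd hxj (hd k hk x hxk)
      · simp [hne j hj, hk] at hxj hxk; exact absurd hxk (hd j hj x hxj)
      · simp [hne j hj, hne k hk] at hxj hxk; exact h2 j hj k hk x hxj hxk
    · intro x
      constructor
      · intro hx
        by_cases h0 : x ∈ W0
        · exact ⟨a, by simp, by simpa using h0⟩
        · obtain ⟨j, hj, hxj⟩ := (h3 x).1 ⟨hx, h0⟩
          exact ⟨j, by simp [hj], by simpa [hne j hj] using hxj⟩
      · rintro ⟨j, hj, hx⟩
        rcases Finset.mem_insert.1 hj with rfl | hj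
        · simp at hx; exact hW0V hx
        · simp [hne j hj] at hx; exact ((h3 x).2 ⟨j, hj, hx⟩).1
    · intro j hj
      rcases Finset.mem_insert.1 hj with rfl | hj
      · simpa using e0
      · simpa [hne j hj] using h4 j hj

open Classical in
theorem EvSys.lift (S : EvSys ev) {ι₀ ι : Type*} [Fintype ι] (t : X → ι₀) (ht : IsLocallyConstant t)
    (ρ : ι → ι₀) (g : ι → I → ℝ) (hg : ∀ j, MM ev (g j))
    (h : ∀ i, ∑ j with ρ j = i, g j = ev {x | t x = i}) :
    ∃ t' : X → ι, IsLocallyConstant t' ∧ (∀ x, ρ (t' x) = t x) ∧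
      ∀ j, ev {x | t' x = j} = g j := by
  choose W h1 h2 h3 h4 using fun i => S.partition (Finset.univ.filter fun j => ρ j = i) g
    (fun j _ => hg j) {x | t x = i} (ht.isClopen_fiber i) (h i)
  have : ∀ x, ∃ j, ρ j = t x ∧ x ∈ W (t x) j := by
    intro x
    obtain ⟨j, hj, hx⟩ := (h3 (t x) x).1 rfl
    exact ⟨j, by simpa using hj, hx⟩
  choose t' ht1 ht2 using this
  have fib : ∀ j, {x | t' x = j} = W (ρ j) j := by
    intro j
    ext x
    constructor
    · rintro rfl
      rw [ht1]; exact ht2 x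
    · intro hx
      have hx' : t x = ρ j := (h3 (ρ j) x).2 ⟨j, by simp, hx⟩
      have := ht2 x
      rw [hx'] at this
      exact h2 (ρ j) (t' x) (by simp [ht1, hx']) j (by simp) x this hx
  refine ⟨t', ?_, ht1, ?_⟩
  · rw [IsLocallyConstant.iff_isOpen_fiber]
    intro j
    have : t' ⁻¹' {j} = W (ρ j) j := fib j
    rw [this]
    exact (h1 _ j (by simp)).isOpen
  · intro j
    rw [fib]; exact h4 _ j (by simp)

end
end ToeplitzProof

namespace ToeplitzProof
section
variable {X I : Type*} [TopologicalSpace X] {ev : Set X → I → ℝ}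

theorem clopen_pred {ι : Type*} {t : X → ι} (ht : IsLocallyConstant t) (P : ι → Prop) :
    IsClopen {x | P (t x)} := by
  have h : ∀ Q : ι → Prop, IsOpen {x | Q (t x)} := fun Q => ht {j | Q j}
  exact ⟨⟨by simpa [Set.compl_def] using h (fun j => ¬ P j)⟩, h P⟩

open Classical in
theorem EvSys.fiber_sum (S : EvSys ev) {ι : Type*} [Fintype ι] {t : X → ι}
    (ht : IsLocallyConstant t) (P : ι → Prop) :
    ev {x | P (t x)} = ∑ j with P j, ev {x | t x = j} := by
  have key : ∀ s : Finset ι, ev {x | t x ∈ s} = ∑ j ∈ s, ev {x | t x = j} := by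
    intro s
    induction s using Finset.induction_on with
    | empty => simpa using S.empty
    | insert a s ha ih =>
      rw [Finset.sum_insert ha, ← ih, ← S.add _ _ (clopen_pred ht (· = a)) (clopen_pred ht (· ∈ s))]
      · congr 1; ext x; simp
      · rw [Set.disjoint_left]; rintro x (rfl : t x = a) h2; exact ha h2
  rw [← key]; congr 1; ext x; simp

theorem EvSys.EE_bound (S : EvSys ev) {g : I → ℝ} (hg : g ∈ EE ev) :
    ∃ N : ℕ, 0 < N ∧ ∀ i, g i < N := by
  obtain ⟨n, l1, l2, hn, h1, h2, h3⟩ := EE.repr hg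
  have hn' : (1:ℝ) ≤ n := by exact_mod_cast hn
  have hb : ∀ l : List (Set X), (∀ U ∈ l, IsClopen U) → ∀ i, 0 ≤ (l.map ev).sum i ∧
      (l.map ev).sum i ≤ l.length := by
    intro l hl i
    induction l with
    | nil => simp
    | cons a l ih =>
      have h := ih (fun U h => hl U (by simp [h]))
      have h1 := S.le_one (hl a (by simp)) i
      have h2 := (S.MM_ev (hl a (by simp))).nonneg i
      simp; constructor <;> linarith
  refine ⟨l1.length + 1, by omega, fun i => ?_⟩
  have a1 := (hb l1 h1 i).2
  have a2 := (hb l2 h2 i).1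
  have a3 := h3 i
  push_cast
  by_contra hc
  push Not at hc
  nlinarith [(Nat.cast_nonneg l1.length : (0:ℝ) ≤ _)]

theorem EvSys.one_mem (S : EvSys ev) : (1 : I → ℝ) ∈ EE ev := by
  rw [← S.univ]; exact EE.ev_mem isClopen_univ

open Classical in
theorem EvSys.riesz (S : EvSys ev) {O C : Type*} [Fintype O] [Fintype C]
    (u : O → I → ℝ) (v : C → I → ℝ) (hu : ∀ o, MM ev (u o)) (hv : ∀ c, MM ev (v c))
    (huv : ∑ o, u o = ∑ c, v c) :
    ∃ r : O → C → I → ℝ, (∀ o c, MM ev (r o c)) ∧ (∀ o, ∑ c, r o c = u o) ∧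
      ∀ c, ∑ o, r o c = v c := by
  have hg := MM.sum Finset.univ u (fun o _ => hu o)
  obtain ⟨N, hN, hb⟩ := S.EE_bound hg.1
  have hNq : (0:ℚ) < N := by exact_mod_cast hN
  have hNr : (0:ℝ) < N := by exact_mod_cast hN
  set g := ∑ o, u o with hgdef
  have hcomp : MM ev (1 - (1 / N : ℚ) • g) := by
    refine ⟨Submodule.sub_mem _ S.one_mem (Submodule.smul_mem _ _ hg.1), Or.inr fun i => ?_⟩
    have := hb i
    simp only [Pi.sub_apply, Pi.one_apply, Pi.smul_apply, Rat.smul_def]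
    push_cast
    rw [one_div, inv_mul_eq_div, sub_pos, div_lt_one hNr]; exact this
  have hNinv : (0:ℚ) ≤ 1 / N := by positivity
  obtain ⟨t1, ht1, -, e1⟩ := S.lift (ι := Option O) (fun _ => ()) (IsLocallyConstant.const ())
    (fun _ => ()) (fun o => o.elim (1 - (1 / N : ℚ) • g) (fun o => (1 / N : ℚ) • u o))
    (by rintro (_ | o)
        · exact hcomp
        · exact (hu o).smul _ hNinv)
    (by intro i
        simp only [Finset.filter_true, Fintype.sum_option, Option.elim]
        rw [← Finset.smul_sum, ← hgdef]
        have : {x : X | (() : Unit) = i} = Set.univ := by ext; simp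
        simp [S.univ])
  obtain ⟨t2, ht2, hρ, e2⟩ := S.lift (ι := Option C) (fun x => (t1 x).isSome) (ht1.comp (fun o : Option O => o.isSome))
    (fun o => o.isSome) (fun o => o.elim (1 - (1 / N : ℚ) • g) (fun o => (1 / N : ℚ) • v o))
    (by rintro (_ | o)
        · exact hcomp
        · exact (hv o).smul _ hNinv)
    (by intro i
        rw [S.fiber_sum ht1 (fun o => o.isSome = i)]
        cases i
        · simp [Finset.sum_filter, Fintype.sum_option, e1]
        · simp [Finset.sum_filter, Fintype.sum_option, e1, ← Finset.smul_sum, ← huv, hgdef])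
  have ht12 : IsLocallyConstant (fun x => (t1 x, t2 x)) := ht1.prodMk ht2
  refine ⟨fun o c => (N : ℚ) • ev {x | (t1 x, t2 x) = (some o, some c)},
    fun o c => (S.MM_ev (ht12.isClopen_fiber _)).smul _ hNq.le, ?_, ?_⟩
  · intro o
    rw [← Finset.smul_sum]
    have h1 := S.fiber_sum ht12 (fun q => q.1 = some o)
    simp only [e1, Option.elim] at h1
    have h2 : ∑ c, ev {x | (t1 x, t2 x) = (some o, some c)} = (1 / N : ℚ) • u o := by
      rw [h1, Finset.sum_filter, Fintype.sum_prod_type, Finset.sum_eq_single (some o)]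
      · rw [Fintype.sum_option]
        have : {x | (t1 x, t2 x) = (some o, none)} = ∅ := by
          ext x; simp; intro h h'; have := hρ x; simp [h, h'] at this
        simp only [if_true]
        rw [this, S.empty, zero_add]
      · intro b _ hb; simp [hb]
      · simp
    rw [h2, smul_smul, mul_one_div_cancel hNq.ne', one_smul]
  · intro c
    rw [← Finset.smul_sum]
    have h1 := S.fiber_sum ht12 (fun q => q.2 = some c)
    simp only [e2, Option.elim] at h1
    have h2 : ∑ o, ev {x | (t1 x, t2 x) = (some o, some c)} = (1 / N : ℚ) • v c := by
      rw [h1, Finset.sum_filter, Fintype.sum_prod_type_right, Finset.sum_eq_single (some c)]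
      · rw [Fintype.sum_option]
        have : {x | (t1 x, t2 x) = (none, some c)} = ∅ := by
          ext x; simp; intro h h'; have := hρ x; simp [h, h'] at this
        simp only [if_true]
        rw [this, S.empty, zero_add]
      · intro b _ hb; simp [hb]
      · simp
    rw [h2, smul_smul, mul_one_div_cancel hNq.ne', one_smul]

end

section
variable {C : Type*} (F : C → ℤ) (cs : C) (L : ℕ)

open Classical in
/-- first letter of the elementary word attached to a pair -/
noncomputable def dX (d : C × C) : C :=
  if F d.1 < 0 ∧ 0 < F d.2 then d.1 else if 0 ≤ F d.1 then d.1 else cs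

open Classical in
/-- second letter of the elementary word attached to a pair -/
noncomputable def dY (d : C × C) : C :=
  if F d.1 < 0 ∧ 0 < F d.2 then d.2 else if 0 ≤ F d.1 then d.1 else cs

open Classical in
/-- length of the first run -/
noncomputable def dM (d : C × C) : ℕ :=
  if F d.1 < 0 ∧ 0 < F d.2 then (L / (F d.2 - F d.1) * F d.2).toNat else L

open Classical in
/-- count of the letter `c` in the elementary word -/
noncomputable def cnt (d : C × C) (c : C) : ℚ :=
  (if dX F cs d = c then (dM F L d : ℚ) else 0) +
    (if dY F cs d = c then (L : ℚ) - (dM F L d : ℚ) else 0)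


theorem dM_mixed (hL : ∀ x y, F x < 0 → 0 < F y → 2 * (F y - F x) ∣ (L : ℤ)) (hL2 : 2 ≤ L)
    (d : C × C) (h1 : F d.1 < 0) (h2 : 0 < F d.2) : ∃ κ : ℤ, 2 ≤ κ ∧
    (dM F L d : ℤ) = κ * F d.2 ∧ (L : ℤ) - dM F L d = κ * (- F d.1) := by
  obtain ⟨e, he⟩ := hL d.1 d.2 h1 h2
  have hpos : 0 < F d.2 - F d.1 := by omega
  have hdiv : (L : ℤ) / (F d.2 - F d.1) = 2 * e := by
    rw [he, mul_comm 2, mul_assoc, Int.mul_ediv_cancel_left _ hpos.ne']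
  have he1 : 1 ≤ e := by
    by_contra hc
    push Not at hc
    have : (2 * (F d.2 - F d.1)) * e ≤ 0 := mul_nonpos_of_nonneg_of_nonpos (by omega) (by omega)
    omega
  have hm : (dM F L d : ℤ) = (2 * e) * F d.2 := by
    rw [dM, if_pos ⟨h1, h2⟩, hdiv, Int.toNat_of_nonneg]
    positivity
  refine ⟨2 * e, by omega, hm, ?_⟩
  rw [hm, he]; ring

theorem dM_le (hL : ∀ x y, F x < 0 → 0 < F y → 2 * (F y - F x) ∣ (L : ℤ)) (hL2 : 2 ≤ L)
    (d : C × C) : dM F L d ≤ L := by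
  by_cases h : F d.1 < 0 ∧ 0 < F d.2
  · obtain ⟨κ, h1, h2, h3⟩ := dM_mixed F L hL hL2 d h.1 h.2
    have : 0 ≤ κ * (- F d.1) := by have := h.1; apply mul_nonneg <;> omega
    omega
  · simp [dM, h]

theorem dM_run (hL : ∀ x y, F x < 0 → 0 < F y → 2 * (F y - F x) ∣ (L : ℤ)) (hL2 : 2 ≤ L)
    (d : C × C) : 2 ≤ dM F L d ∧ (dM F L d = L ∨ dM F L d + 2 ≤ L) := by
  by_cases h : F d.1 < 0 ∧ 0 < F d.2
  · obtain ⟨κ, h1, h2, h3⟩ := dM_mixed F L hL hL2 d h.1 h.2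
    have a1 := h.1
    have a2 := h.2
    constructor
    · have : 2 ≤ κ * F d.2 := by nlinarith
      omega
    · have : 2 ≤ κ * (- F d.1) := by nlinarith
      omega
  · simp [dM, h, hL2]

theorem d_weight (hL : ∀ x y, F x < 0 → 0 < F y → 2 * (F y - F x) ∣ (L : ℤ)) (hL2 : 2 ≤ L)
    (hcs : 0 < F cs) (d : C × C) :
    0 ≤ (dM F L d : ℤ) * F (dX F cs d) + ((L : ℤ) - dM F L d) * F (dY F cs d) := by
  by_cases h : F d.1 < 0 ∧ 0 < F d.2
  · obtain ⟨κ, h1, h2, h3⟩ := dM_mixed F L hL hL2 d h.1 h.2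
    rw [h3, h2, dX, dY, if_pos h, if_pos h]
    apply le_of_eq; ring
  · simp only [dM, h, dX, dY, if_false]
    split_ifs with h'
    · simp; positivity
    · simp; positivity

variable {X I : Type*} [TopologicalSpace X] {ev : Set X → I → ℝ}

open Classical in
theorem EvSys.decomp (hL : ∀ x y, F x < 0 → 0 < F y → 2 * (F y - F x) ∣ (L : ℤ)) (hL2 : 2 ≤ L)
    (S : EvSys ev) [Fintype C] (hcs : 0 < F cs) (α : C → I → ℝ)
    (hα : ∀ c, MM ev (α c)) (hF : ∀ i, 0 < ∑ c, (F c : ℝ) * α c i) :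
    ∃ γ : C × C → I → ℝ, (∀ d, MM ev (γ d)) ∧ ∀ c, α c = ∑ d, cnt F cs L d c • γ d := by
  let P : (C → I → ℝ) → Prop := fun β =>
    ∃ γ : C × C → I → ℝ, (∀ d, MM ev (γ d)) ∧ ∀ c, β c = ∑ d, cnt F cs L d c • γ d
  have P0 : P 0 := ⟨0, fun _ => MM.zero, by simp⟩
  have Padd : ∀ β β', P β → P β' → P (β + β') := by
    rintro β β' ⟨γ, h1, h2⟩ ⟨γ', h1', h2'⟩
    exact ⟨γ + γ', fun d => (h1 d).add (h1' d), fun c => by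
      simp [h2, h2', Finset.sum_add_distrib]⟩
  have Psum : ∀ {ι : Type _} (s : Finset ι) (β : ι → C → I → ℝ), (∀ j ∈ s, P (β j)) →
      P (∑ j ∈ s, β j) := by
    intro ι s β h
    exact Finset.sum_induction _ P Padd P0 h
  have Pgen : ∀ (d : C × C) g, MM ev g → P (fun c => cnt F cs L d c • g) := by
    intro d g hg
    refine ⟨Pi.single d g, ?_, ?_⟩
    · intro d'
      by_cases h : d' = d
      · subst h; simpa using hg
      · simpa [h] using MM.zero
    · intro c
      rw [Finset.sum_eq_single d]
      · simp
      · intro b _ hb; simp [hb]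
      · simp
  have hLq : (0:ℚ) < L := by exact_mod_cast (by omega : 0 < L)
  have Psingle : ∀ x g, 0 ≤ F x → MM ev g → P (Pi.single x g) := by
    intro x g hx hg
    have := Pgen (x, x) ((1 / L : ℚ) • g) (hg.smul _ (by positivity))
    convert this using 1
    funext c
    have hx' : ¬ F x < 0 := by omega
    simp only [cnt, dX, dY, dM, hx', false_and, if_false, hx, if_true]
    by_cases hc : x = c
    · subst hc
      simp [smul_smul, hLq.ne']
    · have : c ≠ x := fun h => hc h.symm
      simp [hc, this]
  have Pmix : ∀ x y g, F x < 0 → 0 < F y → MM ev g →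
      P (Pi.single x ((F y : ℚ) • g) + Pi.single y ((-F x : ℚ) • g)) := by
    intro x y g hx hy hg
    obtain ⟨κ, h1, h2, h3⟩ := dM_mixed F L hL hL2 (x, y) hx hy
    have hκ : (0:ℚ) < κ := by exact_mod_cast (by omega : 0 < κ)
    have h2' : (dM F L (x, y) : ℚ) = κ * F y := by exact_mod_cast h2
    have h3' : (L : ℚ) - dM F L (x, y) = κ * (- F x) := by exact_mod_cast h3
    have := Pgen (x, y) ((1 / κ : ℚ) • g) (hg.smul _ (by positivity))
    convert this using 1
    funext c
    rw [cnt, h3']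
    simp only [h2', dX, dY, hx, hy, and_self, if_true, Pi.add_apply, add_smul,
      Pi.single_apply]
    congr 1
    · by_cases hc : x = c
      · subst hc; simp only [if_true, smul_smul]; congr 1; field_simp
      · have : c ≠ x := fun h => hc h.symm
        simp [hc, this]
    · by_cases hc : y = c
      · subst hc; simp only [if_true, smul_smul]; congr 1; field_simp
      · have : c ≠ y := fun h => hc h.symm
        simp [hc, this]
  -- transport
  have hslack : MM ev (∑ c, (F c : ℚ) • α c) := by
    refine ⟨Submodule.sum_mem _ fun c _ => Submodule.smul_mem _ _ (hα c).1, Or.inr fun i => ?_⟩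
    have := hF i
    simpa [Finset.sum_apply, Rat.smul_def] using this
  obtain ⟨r, hr, hr1, hr2⟩ := S.riesz (O := Option C) (C := C)
    (fun o => o.elim (∑ c, (F c : ℚ) • α c) (fun c => (max (-F c) 0 : ℚ) • α c))
    (fun c => (max (F c) 0 : ℚ) • α c)
    (by rintro (_ | c)
        · exact hslack
        · exact (hα c).smul _ (le_max_right _ _))
    (fun c => (hα c).smul _ (le_max_right _ _))
    (by
      rw [Fintype.sum_option]
      simp only [Option.elim]
      rw [← Finset.sum_add_distrib]
      refine Finset.sum_congr rfl fun c _ => ?_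
      rw [← add_smul]
      congr 1
      rcases le_total (F c : ℚ) 0 with h | h
      · rw [max_eq_right h, max_eq_left (by linarith)]; ring
      · rw [max_eq_left h, max_eq_right (by linarith)]; ring)
  have hzero : ∀ {ι : Type _} (s : Finset ι) (g : ι → I → ℝ), (∀ j, MM ev (g j)) →
      ∑ j ∈ s, g j = 0 → ∀ j ∈ s, g j = 0 := by
    intro ι s g hg h
    exact (Finset.sum_eq_zero_iff_of_nonneg (fun j _ i => (hg j).nonneg i)).1 h
  have hz1 : ∀ o y, F y ≤ 0 → r o y = 0 := by
    intro o y hy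
    refine hzero Finset.univ (fun o => r o y) (fun o => hr o y) ?_ o (Finset.mem_univ _)
    have h' : (F y : ℚ) ≤ 0 := by exact_mod_cast hy
    rw [hr2, max_eq_right h', zero_smul]
  have hz2 : ∀ x y, 0 ≤ F x → r (some x) y = 0 := by
    intro x y hx
    refine hzero Finset.univ (fun y => r (some x) y) (fun y => hr _ y) ?_ y (Finset.mem_univ _)
    have h' : -(F x : ℚ) ≤ 0 := by simpa using hx
    rw [hr1]
    simp only [Option.elim]
    rw [max_eq_right h', zero_smul]
  have hmain : α = (∑ x, ∑ y, (if F x < 0 ∧ 0 < F y then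
        Pi.single x ((F y : ℚ) • ((1 / (F y * -F x) : ℚ) • r (some x) y)) +
        Pi.single y ((-F x : ℚ) • ((1 / (F y * -F x) : ℚ) • r (some x) y)) else 0)) +
      (∑ y, (if 0 < F y then Pi.single y ((1 / F y : ℚ) • r none y) else 0)) +
      ∑ x, (if F x = 0 then Pi.single x (α x) else 0) := by
    have e1 : ∀ x y, (if F x < 0 ∧ 0 < F y then
        (Pi.single x ((F y : ℚ) • ((1 / (F y * -F x) : ℚ) • r (some x) y)) +
        Pi.single y ((-F x : ℚ) • ((1 / (F y * -F x) : ℚ) • r (some x) y)) : C → I → ℝ) else 0)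
        = Pi.single x ((1 / (-F x) : ℚ) • r (some x) y) +
          Pi.single y ((1 / F y : ℚ) • r (some x) y) := by
      intro x y
      split_ifs with h
      · have h1 : (F x : ℚ) ≠ 0 := by exact_mod_cast h.1.ne
        have h2 : (F y : ℚ) ≠ 0 := by exact_mod_cast h.2.ne'
        rw [smul_smul, smul_smul]
        congr 3
        · field_simp
        · field_simp
      · have : r (some x) y = 0 := by
          by_cases hx : F x < 0
          · exact hz1 _ _ (by by_contra hc; exact h ⟨hx, by omega⟩)
          · exact hz2 _ _ (by omega)
        simp [this]
    have e2 : ∀ y, (if 0 < F y then (Pi.single y ((1 / F y : ℚ) • r none y) : C → I → ℝ) else 0)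
        = Pi.single y ((1 / F y : ℚ) • r none y) := by
      intro y
      split_ifs with h
      · rfl
      · rw [hz1 _ _ (by omega)]; simp
    simp only [e1, e2]
    funext c
    simp only [Pi.add_apply, Finset.sum_apply, Pi.single_apply, Finset.sum_add_distrib]
    have t1 : ∑ x, ∑ y, (if c = x then (1 / (-F x) : ℚ) • r (some x) y else 0) =
        (1 / (-F c) : ℚ) • (max (-F c) 0 : ℚ) • α c := by
      rw [Finset.sum_eq_single c]
      · simp only [if_true]
        rw [← Finset.smul_sum, hr1]; rfl
      · intro b _ hb; simp [hb.symm]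
      · simp
    have t2 : ∑ x, ∑ y, (if c = y then (1 / (F y) : ℚ) • r (some x) y else 0) =
        (1 / (F c) : ℚ) • ∑ x, r (some x) c := by
      rw [Finset.smul_sum]
      refine Finset.sum_congr rfl fun x _ => ?_
      simp
    have t3 : ∑ y, (if c = y then (1 / (F y) : ℚ) • r none y else 0) =
        (1 / (F c) : ℚ) • r none c := by simp
    have t4 : ∑ x, (if F x = 0 then (Pi.single x (α x) : C → I → ℝ) else 0) c =
        if F c = 0 then α c else 0 := by
      rw [Finset.sum_eq_single c]
      · split_ifs <;> simp
      · intro b _ hb; split_ifs <;> simp [hb.symm]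
      · simp
    have t5 := hr2 c
    rw [Fintype.sum_option] at t5
    have t6 : (1 / (F c) : ℚ) • ∑ x, r (some x) c + (1 / (F c) : ℚ) • r none c =
        (1 / (F c) : ℚ) • (max (F c) 0 : ℚ) • α c := by
      rw [← t5, smul_add, add_comm]
    rw [t1, t2, t3, t4, add_assoc (_ • _), t6]
    rcases lt_trichotomy (F c) 0 with h | h | h
    · have h' : (F c : ℚ) < 0 := by exact_mod_cast h
      rw [max_eq_left (by linarith), max_eq_right h'.le, smul_smul, if_neg h.ne, zero_smul, smul_zero,
        one_div, inv_mul_cancel₀ (by linarith : (-F c : ℚ) ≠ 0), one_smul]; simp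
    · simp [h]
    · have h' : (0:ℚ) < F c := by exact_mod_cast h
      rw [max_eq_right (by linarith), max_eq_left h'.le, smul_smul (1 / (F c : ℚ)), if_neg h.ne',
        zero_smul, smul_zero,
        one_div (F c : ℚ), inv_mul_cancel₀ h'.ne', one_smul]; simp
  show P α
  rw [hmain]
  refine Padd _ _ (Padd _ _ ?_ ?_) ?_
  · refine Psum _ _ fun x _ => Psum _ _ fun y _ => ?_
    split_ifs with h
    · refine Pmix x y _ h.1 h.2 ((hr _ _).smul _ ?_)
      have h1 : (F x : ℚ) < 0 := by exact_mod_cast h.1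
      have h2 : (0 : ℚ) < F y := by exact_mod_cast h.2
      have h3 : (0:ℚ) < -F x := by linarith
      positivity
    · exact P0
  · refine Psum _ _ fun y _ => ?_
    split_ifs with h
    · have h2 : (0 : ℚ) < F y := by exact_mod_cast h
      exact Psingle y _ h.le ((hr _ _).smul _ (by positivity))
    · exact P0
  · refine Psum _ _ fun x _ => ?_
    split_ifs with h
    · exact Psingle x _ h.ge (hα x)
    · exact P0
end
end ToeplitzProof

namespace ToeplitzProof

section words
variable {C B : Type*}

/-- the words used in the construction -/
def wd (k T L m e : ℕ) (a b x y : C) (j : ℕ) : C :=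
  if j < T then (if j = k ∨ j = k + 2 ∨ j = k + 5 + e then b else a)
  else if j < T + L then (if j < T + m then x else y) else a

theorem wd_map (ν : C → B) (k T L m e : ℕ) (a b x y : C) (j : ℕ) :
    ν (wd k T L m e a b x y j) = wd k T L m e (ν a) (ν b) (ν x) (ν y) j := by
  unfold wd; split_ifs <;> rfl

theorem wd_sum (k T L m e : ℕ) (a b x y : C) (hT : k + 5 + e < T) (hm : m ≤ L) (G : C → ℚ) :
    ∑ j ∈ Finset.range (T + L + 1), G (wd k T L m e a b x y j) =
      ((T : ℚ) - 2) * G a + 3 * G b + m * G x + ((L : ℚ) - m) * G y := by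
  rw [Finset.sum_range_succ, Finset.sum_range_add]
  have h1 : ∑ j ∈ Finset.range T, G (wd k T L m e a b x y j) = T * G a + 3 * (G b - G a) := by
    have : ∀ j ∈ Finset.range T, G (wd k T L m e a b x y j) = G a +
        ((if j = k then G b - G a else 0) + (if j = k + 2 then G b - G a else 0) +
          (if j = k + 5 + e then G b - G a else 0)) := by
      intro j hj
      rw [Finset.mem_range] at hj
      simp only [wd, hj, if_true]
      by_cases a1 : j = k
      · have : j ≠ k + 2 := by omega
        have : j ≠ k + 5 + e := by omega
        subst a1; simp [*]
      · by_cases a2 : j = k + 2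
        · have : j ≠ k + 5 + e := by omega
          simp_all
        · by_cases a3 : j = k + 5 + e
          · simp only [a3, if_true, or_true]
            simp only [← a3, a1, a2, if_false]; ring
          · simp [a1, a2, a3]
    rw [Finset.sum_congr rfl this, Finset.sum_add_distrib, Finset.sum_add_distrib,
      Finset.sum_add_distrib]
    simp only [Finset.sum_ite_eq', Finset.mem_range, Finset.sum_const, Finset.card_range]
    rw [if_pos (by omega), if_pos (by omega), if_pos (by omega)]
    simp only [nsmul_eq_mul]; ring
  have h2 : ∑ j ∈ Finset.range L, G (wd k T L m e a b x y (T + j)) = m * G x + ((L : ℚ) - m) * G y := by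
    obtain ⟨m', rfl⟩ := Nat.exists_eq_add_of_le hm
    rw [Finset.sum_range_add]
    have e1 : ∀ j ∈ Finset.range m, G (wd k T (m + m') m e a b x y (T + j)) = G x := by
      intro j hj
      rw [Finset.mem_range] at hj
      simp [wd, hj, show j < m + m' by omega]
    have e2 : ∀ j ∈ Finset.range m', G (wd k T (m + m') m e a b x y (T + (m + j))) = G y := by
      intro j hj
      rw [Finset.mem_range] at hj
      simp [wd, hj]
    rw [Finset.sum_congr rfl e1, Finset.sum_congr rfl e2]
    simp
  have h3 : wd k T L m e a b x y (T + L) = a := by simp [wd]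
  rw [h1, h2, h3]; ring

/-- recognizability of a family of words -/
def Recog {D : Type*} (w : D → ℕ → C) (q : ℕ) : Prop :=
  ∃ (a b : C) (k : ℕ), a ≠ b ∧ 1 ≤ k ∧ k + 2 < q ∧
    (∀ d, w d (k - 1) = a ∧ w d k = b ∧ w d (k + 1) = a ∧ w d (k + 2) = b) ∧
    (∀ d j, j < q → w d j = b → (1 ≤ j → w d (j - 1) = a) → (j + 1 < q → w d (j + 1) = a) →
      (j + 2 < q → w d (j + 2) = b) → j = k) ∧
    ∃ e : D → ℕ, ∀ d, e d < q ∧ w d (e d) = b ∧ ∀ d', w d' (e d) = b → d = d'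

theorem wd_unique (k T L m e : ℕ) (a b x y : C) (hab : a ≠ b) (hk : 1 ≤ k) (hT : k + 8 + e ≤ T)
    (hm : 2 ≤ m) (hm' : m = L ∨ m + 2 ≤ L) (j : ℕ) (hj : j < T + L + 1)
    (h0 : wd k T L m e a b x y j = b) (h1 : 1 ≤ j → wd k T L m e a b x y (j - 1) = a)
    (h2 : j + 1 < T + L + 1 → wd k T L m e a b x y (j + 1) = a)
    (h3 : j + 2 < T + L + 1 → wd k T L m e a b x y (j + 2) = b) : j = k := by
  by_cases hjT : j < T
  · simp only [wd, hjT, if_true] at h0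
    split_ifs at h0 with hh
    · rcases hh with rfl | rfl | rfl
      · rfl
      · have := h3 (by omega)
        have e1 : k + 2 + 2 < T := by omega
        have e2 : ¬ (k + 2 + 2 = k ∨ k + 2 + 2 = k + 2 ∨ k + 2 + 2 = k + 5 + e) := by omega
        simp only [wd, e1, if_true, e2, if_false] at this
        exact absurd this hab
      · have := h3 (by omega)
        have e1 : k + 5 + e + 2 < T := by omega
        have e2 : ¬ (k + 5 + e + 2 = k ∨ k + 5 + e + 2 = k + 2 ∨ k + 5 + e + 2 = k + 5 + e) := by omega
        simp only [wd, e1, if_true, e2, if_false] at this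
        exact absurd this hab
    · exact absurd h0 hab
  · exfalso
    have h1 := h1 (by omega)
    have d0 : ∀ j, T ≤ j → j < T + m → wd k T L m e a b x y j = x := by
      intro j h h'
      simp [wd, show ¬ j < T by omega, show j < T + L by omega, h']
    have d1 : ∀ j, T + m ≤ j → j < T + L → wd k T L m e a b x y j = y := by
      intro j h h'
      simp [wd, show ¬ j < T by omega, show ¬ j < T + m by omega, h']
    by_cases hjL : j < T + L
    · have h2 := h2 (by omega)
      by_cases hjm : j < T + m
      · rw [d0 j (by omega) hjm] at h0
        by_cases hjj : j = T
        · rw [d0 _ (by omega) (by omega)] at h2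
          exact hab (h2.symm.trans h0)
        · rw [d0 _ (by omega) (by omega)] at h1
          exact hab (h1.symm.trans h0)
      · rw [d1 j (by omega) hjL] at h0
        by_cases hjj : j + 1 < T + L
        · rw [d1 _ (by omega) (by omega)] at h2
          exact hab (h2.symm.trans h0)
        · rw [d1 _ (by omega) (by omega)] at h1
          exact hab (h1.symm.trans h0)
    · simp [wd, hjT, hjL] at h0
      exact hab h0

theorem wd_recog {D : Type*} (k T L : ℕ) (m e : D → ℕ) (he : Function.Injective e) (a b : C)
    (x y : D → C) (hab : a ≠ b)
    (hk : 1 ≤ k) (hT : ∀ d, k + 8 + e d ≤ T) (hT' : k + 8 ≤ T)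
    (hm : ∀ d, 2 ≤ m d) (hm' : ∀ d, m d = L ∨ m d + 2 ≤ L) :
    Recog (fun d => wd k T L (m d) (e d) a b (x d) (y d)) (T + L + 1) := by
  refine ⟨a, b, k, hab, hk, by omega, ?_, ?_, fun d => k + 5 + e d, ?_⟩
  · intro d
    have := hT d
    refine ⟨?_, ?_, ?_, ?_⟩
    · simp only [wd]; rw [if_pos (by omega), if_neg (by omega)]
    · simp only [wd]; rw [if_pos (by omega), if_pos (by simp)]
    · simp only [wd]; rw [if_pos (by omega), if_neg (by omega)]
    · simp only [wd]; rw [if_pos (by omega), if_pos (by simp)]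
  · intro d j
    exact wd_unique k T L (m d) (e d) a b (x d) (y d) hab hk (hT d) (hm d) (hm' d) j
  · intro d
    have := hT d
    refine ⟨by show k + 5 + e d < _; omega, ?_, ?_⟩
    · simp only [wd]; rw [if_pos (by omega), if_pos (by simp)]
    · intro d' h
      simp only [wd] at h
      rw [if_pos (by omega)] at h
      split_ifs at h with h'
      · apply he; omega
      · exact absurd h hab
end words

section
variable {X I : Type*} [TopologicalSpace X] {ev : Set X → I → ℝ}

open Classical in
theorem EvSys.refine (S : EvSys ev) {C V : Type*} [Fintype C] [Fintype V] {p : ℕ} (hp : 0 < p)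
    (st : X → C × Fin p) (hst : IsLocallyConstant st)
    (eqm : ∀ c i j, ev {x | st x = (c, i)} = ev {x | st x = (c, j)})
    (f : X → V) (hf : IsLocallyConstant f) :
    ∃ st1 : X → (C × (Fin p → V)) × Fin p, IsLocallyConstant st1 ∧
      (∀ x, ((st1 x).1.1, (st1 x).2) = st x) ∧ (∀ x, (st1 x).1.2 (st1 x).2 = f x) ∧
      ∀ c i j, ev {x | st1 x = (c, i)} = ev {x | st1 x = (c, j)} := by
  have hstf : IsLocallyConstant (fun x => (st x, f x)) := hst.prodMk hf
  -- copy the partition of each level to every level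
  have hk : ∀ k : Fin p, ∃ g : X → V, IsLocallyConstant g ∧
      ∀ c i v, ev {x | (st x, g x) = ((c, i), v)} = ev {x | (st x, f x) = ((c, k), v)} := by
    intro k
    obtain ⟨t', h1, h2, h3⟩ := S.lift (ι := (C × Fin p) × V) st hst (fun j => j.1)
      (fun j => ev {x | (st x, f x) = ((j.1.1, k), j.2)})
      (fun j => S.MM_ev (hstf.isClopen_fiber _)) (by
        rintro ⟨c, i⟩
        rw [eqm c i k]
        have := S.fiber_sum hstf (fun j => j.1 = (c, k))
        rw [this]
        refine Finset.sum_nbij' (fun j => ((c, k), j.2)) (fun j => ((c, i), j.2)) ?_ ?_ ?_ ?_ ?_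
        · simp
        · simp
        · rintro ⟨⟨c', i'⟩, v⟩ h; simp at h; simp [h]
        · rintro ⟨⟨c', i'⟩, v⟩ h; simp at h; simp [h]
        · rintro ⟨⟨c', i'⟩, v⟩ h; simp at h; simp [h])
    refine ⟨fun x => (t' x).2, h1.comp Prod.snd, ?_⟩
    intro c i v
    rw [← h3 ((c, i), v)]
    congr 1; ext x
    simp only [mem_ofPred_eq, ← h2 x]
  choose g hg1 hg2 using hk
  have hgl : IsLocallyConstant (fun x => fun k => g k x) := by
    rw [IsLocallyConstant.iff_isOpen_fiber]
    intro η
    have : (fun x => fun k => g k x) ⁻¹' {η} = ⋂ k, {x | g k x = η k} := by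
      ext x; simp [funext_iff]
    rw [this]
    exact isOpen_iInter_of_finite fun k => (hg1 k).isOpen_fiber _
  have hT := hst.prodMk hgl
  obtain ⟨t', h1, h2, h3⟩ := S.lift (ι := (C × (Fin p → V)) × Fin p) (fun x => (st x, f x)) hstf
    (fun j => ((j.1.1, j.2), j.1.2 j.2))
    (fun j => ev {x | (st x, fun k => g k x) = ((j.1.1, ⟨0, hp⟩), j.1.2)})
    (fun j => S.MM_ev (hT.isClopen_fiber _)) (by
      rintro ⟨⟨c, i⟩, v⟩
      rw [← hg2 i c ⟨0, hp⟩ v]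
      have := S.fiber_sum hT (fun j => (j.1, j.2 i) = ((c, ⟨0, hp⟩), v))
      rw [this]
      refine Finset.sum_nbij' (fun j => ((c, ⟨0, hp⟩), j.1.2)) (fun j => ((c, j.2), i)) ?_ ?_ ?_ ?_ ?_
      · rintro ⟨⟨c', η⟩, i'⟩ h
        simp only [Finset.mem_filter, Finset.mem_univ, true_and, Prod.mk.injEq] at h ⊢
        obtain ⟨⟨rfl, rfl⟩, h⟩ := h
        exact h
      · rintro ⟨⟨c', i'⟩, η⟩ h
        simp only [Finset.mem_filter, Finset.mem_univ, true_and, Prod.mk.injEq] at h ⊢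
        exact h.2
      · rintro ⟨⟨c', η⟩, i'⟩ h
        simp only [Finset.mem_filter, Finset.mem_univ, true_and, Prod.mk.injEq] at h ⊢
        obtain ⟨⟨rfl, rfl⟩, h⟩ := h
        simp
      · rintro ⟨⟨c', i'⟩, η⟩ h
        simp only [Finset.mem_filter, Finset.mem_univ, true_and, Prod.mk.injEq] at h ⊢
        simp [h]
      · rintro ⟨⟨c', η⟩, i'⟩ h
        simp only [Finset.mem_filter, Finset.mem_univ, true_and, Prod.mk.injEq] at h ⊢
        obtain ⟨⟨rfl, rfl⟩, h⟩ := h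
        rfl)
  refine ⟨t', h1, ?_, ?_, ?_⟩
  · intro x; exact congrArg Prod.fst (h2 x)
  · intro x; exact congrArg Prod.snd (h2 x)
  · intro c i j; rw [h3, h3]

end
end ToeplitzProof

namespace ToeplitzProof
section
variable {X I : Type*} [TopologicalSpace X] {ev : Set X → I → ℝ}

open Classical in
theorem EvSys.alpha_sum (S : EvSys ev) {C : Type*} [Fintype C] {p : ℕ} (hp : 0 < p)
    (st : X → C × Fin p) (hst : IsLocallyConstant st)
    (eqm : ∀ c i j, ev {x | st x = (c, i)} = ev {x | st x = (c, j)}) :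
    ∑ c, ev {x | st x = (c, (⟨0, hp⟩ : Fin p))} = (1 / (p : ℚ)) • (1 : I → ℝ) := by
  have h := S.fiber_sum hst (fun _ => True)
  have h2 : {x : X | True} = Set.univ := by ext; simp
  rw [h2, S.univ] at h
  simp only [Finset.filter_true, Fintype.sum_prod_type] at h
  have h3 : ∀ c, ∑ i, ev {x | st x = (c, i)} = (p : ℚ) • ev {x | st x = (c, (⟨0, hp⟩ : Fin p))} := by
    intro c
    rw [Finset.sum_congr rfl (fun i _ => eqm c i ⟨0, hp⟩)]
    rw [Finset.sum_const, Finset.card_univ, Fintype.card_fin, Nat.cast_smul_eq_nsmul]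
  rw [Finset.sum_congr rfl (fun c _ => h3 c), ← Finset.smul_sum] at h
  have hp' : (p : ℚ) ≠ 0 := by exact_mod_cast hp.ne'
  rw [h, smul_smul, one_div, inv_mul_cancel₀ hp', one_smul]

theorem cnt_sum {C : Type*} [Fintype C] (F : C → ℤ) (cs : C) (L : ℕ) (d : C × C) :
    ∑ c, cnt F cs L d c = L := by
  classical
  simp [cnt, Finset.sum_add_distrib]

set_option maxHeartbeats 1000000 in
open Classical in
theorem EvSys.growth (S : EvSys ev) {C B : Type*} [Fintype C] {p : ℕ} (hp : 0 < p)
    (st : X → C × Fin p) (hst : IsLocallyConstant st)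
    (eqm : ∀ c i j, ev {x | st x = (c, i)} = ev {x | st x = (c, j)})
    (ν : C → B) (hν : ∃ x x', ν (st x).1 ≠ ν (st x').1)
    (F : C → ℤ) (hF : ∀ i, 0 < ∑ c, (F c : ℝ) * ev {x | st x = (c, (⟨0, hp⟩ : Fin p))} i) :
    ∃ (s q : ℕ) (w : Fin s → ℕ → C) (c0 : C) (t : X → Fin s × Fin q × Fin p),
      2 ≤ q ∧ IsLocallyConstant t ∧ (∀ x, (w (t x).1 (t x).2.1, (t x).2.2) = st x) ∧
      (∀ d b b' i i', ev {x | t x = (d, b, i)} = ev {x | t x = (d, b', i')}) ∧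
      (∀ d, w d 0 = c0 ∧ w d (q - 1) = c0) ∧ Recog (fun d j => ν (w d j)) q ∧
      (∀ d, 0 ≤ ∑ b ∈ Finset.range q, F (w d b)) ∧ ∃ x x', (t x).1 ≠ (t x').1 := by
  set z : Fin p := ⟨0, hp⟩ with hz
  set α : C → I → ℝ := fun c => ev {x | st x = (c, z)} with hαdef
  have hcl : ∀ c, IsClopen {x | st x = (c, z)} := fun c => hst.isClopen_fiber _
  have hα : ∀ c, MM ev (α c) := fun c => S.MM_ev (hcl c)
  have hαst : ∀ x i, 0 < α (st x).1 i := by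
    intro x i
    rw [hαdef]
    simp only
    rw [eqm _ z (st x).2]
    exact S.pos _ (hst.isClopen_fiber _) ⟨x, rfl⟩ i
  obtain ⟨i0⟩ := S.ne
  have hzero : ∀ c, (¬ ∃ x, (st x).1 = c) → α c = 0 := by
    intro c hc
    rw [hαdef]
    simp only
    rw [← S.empty]; congr 1; ext x
    simp only [mem_ofPred_eq, mem_empty_iff_false, iff_false]
    intro h; exact hc ⟨x, by rw [h]⟩
  -- the letter cs
  obtain ⟨cs, hcs, xcs, hxcs⟩ : ∃ cs, 0 < F cs ∧ ∃ x, (st x).1 = cs := by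
    by_contra hcon
    push Not at hcon
    have := hF i0
    refine absurd this (not_lt.2 (Finset.sum_nonpos fun c _ => ?_))
    by_cases h : 0 < F c
    · have := hzero c (by push Not; exact hcon c h)
      simp only [hαdef] at this
      rw [this]; simp
    · have h1 : (F c : ℝ) ≤ 0 := by exact_mod_cast not_lt.1 h
      exact mul_nonpos_of_nonpos_of_nonneg h1 ((hα c).nonneg i0)
  obtain ⟨c2, hc2, xc2, hxc2⟩ : ∃ c2, ν c2 ≠ ν cs ∧ ∃ x, (st x).1 = c2 := by
    obtain ⟨x, x', hne⟩ := hν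
    by_cases h : ν (st x).1 = ν cs
    · exact ⟨(st x').1, fun h' => hne (h.trans h'.symm), x', rfl⟩
    · exact ⟨(st x).1, h, x, rfl⟩
  have hcc : cs ≠ c2 := fun h => hc2 (by rw [h])
  obtain ⟨N1, hN1, hN1'⟩ := S.bdd (α cs) (hα cs).1 (by rw [← hxcs]; exact hαst _)
  obtain ⟨N2, hN2, hN2'⟩ := S.bdd (α c2) (hα c2).1 (by rw [← hxc2]; exact hαst _)
  obtain ⟨N3, hN3, hN3'⟩ := S.bdd (∑ c, (F c : ℚ) • α c)
    (Submodule.sum_mem _ fun c _ => Submodule.smul_mem _ _ (hα c).1)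
    (fun i => by simpa [Finset.sum_apply, Rat.smul_def] using hF i)
  set N := N1 + N2 + N3 with hN
  let e := Fintype.equivFin ((C × C) × Bool)
  set s' := Fintype.card ((C × C) × Bool) with hs'
  set k := 3 + 3 * (F c2).natAbs with hk
  set T := k + 8 + s' with hT
  set Q := ∏ d : C × C, max 1 (F d.2 - F d.1).natAbs with hQ
  have hQ1 : 1 ≤ Q := Nat.one_le_iff_ne_zero.2 (Finset.prod_ne_zero_iff.2 fun d _ => by
    have := le_max_left 1 (F d.2 - F d.1).natAbs; omega)
  set Bd := T * (F cs).natAbs + 3 * (F c2).natAbs with hBd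
  set R := N * (T + Bd + 3) + 1 with hR
  set L := 2 * (Q * R) with hLdef
  have hLR : 2 * R ≤ L := by rw [hLdef]; gcongr; exact Nat.le_mul_of_pos_left _ hQ1
  have hL2 : 2 ≤ L := by omega
  have hL : ∀ x y, F x < 0 → 0 < F y → 2 * (F y - F x) ∣ (L : ℤ) := by
    intro x y hx hy
    have h1 : max 1 (F y - F x).natAbs ∣ Q :=
      Finset.dvd_prod_of_mem (fun d : C × C => max 1 (F d.2 - F d.1).natAbs) (Finset.mem_univ (x, y))
    have h2 : ((max 1 (F y - F x).natAbs : ℕ) : ℤ) = F y - F x := by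
      rw [max_eq_right (by omega)]; omega
    have h3 : F y - F x ∣ (Q : ℤ) := by rw [← h2]; exact_mod_cast h1
    rw [hLdef]; push_cast
    exact mul_dvd_mul_left 2 (h3.mul_right _)
  set q := T + L + 1 with hq
  set ε : ℚ := 1 / (p * q) with hε
  have hpq : (0:ℚ) < p := by exact_mod_cast hp
  have hqq : (0:ℚ) < q := by exact_mod_cast (by omega : 0 < q)
  have hε0 : 0 < ε := by positivity
  -- key smallness
  have hεsmall : ∀ (M N' : ℕ) (r : ℝ), M ≤ T + Bd + 3 → N' ≤ N → 1 < N' * r → (ε : ℝ) * M < r := by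
    intro M N' r hM hN' hr
    have hN'0 : (0:ℝ) < N' := by
      rcases Nat.eq_zero_or_pos N' with h | h
      · rw [h] at hr; norm_num at hr
      · exact_mod_cast h
    have h1 : N' * M < q := by
      have : N' * M ≤ N * (T + Bd + 3) := Nat.mul_le_mul hN' hM
      omega
    have h1' : (N' * M : ℝ) < q := by exact_mod_cast h1
    have h2 : (1:ℝ) ≤ p := by exact_mod_cast hp
    have hq0 : (0:ℝ) < q := by exact_mod_cast hqq
    have h3 : (ε : ℝ) = 1 / (p * q) := by rw [hε]; push_cast; rfl
    have h4 : (ε : ℝ) * (N' * M) < 1 := by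
      rw [h3, one_div, inv_mul_lt_iff₀ (by positivity)]
      nlinarith
    by_contra hc
    push Not at hc
    nlinarith
  set rr : C → ℚ := fun c => (if cs = c then ((T:ℚ) - 2) else 0) + (if c2 = c then 3 else 0) with hrr
  set α' : C → I → ℝ := fun c => α c - (ε * rr c) • (1 : I → ℝ) with hα'
  have hα'M : ∀ c, MM ev (α' c) := by
    intro c
    refine ⟨Submodule.sub_mem _ (hα c).1 (Submodule.smul_mem _ _ S.one_mem), ?_⟩
    by_cases h1 : cs = c
    · right; intro i
      have hh := hεsmall T N1 (α cs i) (by omega) (by omega) (hN1' i)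
      have : c2 ≠ c := fun h => hcc (h1.trans h.symm)
      have h0 : (0:ℝ) < ε := by exact_mod_cast hε0
      simp only [hα', hrr, this, h1, if_true, if_false, Pi.sub_apply, Pi.smul_apply, Rat.smul_def, Pi.one_apply]
      push_cast
      rw [h1] at hh
      nlinarith
    by_cases h2 : c2 = c
    · right; intro i
      have hh := hεsmall 3 N2 (α c2 i) (by omega) (by omega) (hN2' i)
      simp only [hα', hrr, h1, h2, if_true, if_false, Pi.sub_apply, Pi.smul_apply, Rat.smul_def, Pi.one_apply]
      push_cast
      rw [h2] at hh
      push_cast at hh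
      linarith
    · have : α' c = α c := by simp [hα', hrr, h1, h2]
      rw [this]; exact (hα c).2
  have hrsum : ∀ G : C → ℚ, ∑ c, rr c * G c = (T - 2) * G cs + 3 * G c2 := by
    intro G
    simp [hrr, add_mul, Finset.sum_add_distrib]
  have hF' : ∀ i, 0 < ∑ c, (F c : ℝ) * α' c i := by
    intro i
    have h1 := hεsmall Bd N3 ((∑ c, (F c : ℚ) • α c) i) (by omega) (by omega) (hN3' i)
    have h2 : ∑ c, (F c : ℝ) * α' c i = (∑ c, (F c : ℚ) • α c) i - ε * ((∑ c, rr c * (F c : ℚ) : ℚ) : ℝ) := by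
      simp only [hα', Finset.sum_apply, Pi.sub_apply, Pi.smul_apply, Rat.smul_def, Pi.one_apply]
      push_cast
      rw [Finset.mul_sum, ← Finset.sum_sub_distrib]
      refine Finset.sum_congr rfl fun c _ => ?_
      ring
    rw [h2, hrsum]
    have h3 : ((T:ℚ) - 2) * F cs + 3 * F c2 ≤ Bd := by
      rw [hBd]; push_cast
      have a1 : ((F cs).natAbs : ℚ) = F cs := by
        rw [Nat.cast_natAbs]; rw [abs_of_pos hcs]
      have a2 : (F c2 : ℚ) ≤ ((F c2).natAbs : ℚ) := by
        rw [Nat.cast_natAbs]; exact_mod_cast le_abs_self _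
      have a3 : (0:ℚ) < F cs := by exact_mod_cast hcs
      rw [a1]; nlinarith
    have h3' : (((T:ℚ) - 2) * F cs + 3 * F c2 : ℚ) ≤ (Bd : ℝ) := by exact_mod_cast h3
    have h0 : (0:ℝ) < ε := by exact_mod_cast hε0
    nlinarith
  obtain ⟨γ, hγ, hγ'⟩ := S.decomp F cs L hL hL2 hcs α' hα'M hF'
  have hsumγ : ∑ d, γ d = ε • (1 : I → ℝ) := by
    have h1 : ∑ c, α' c = (L : ℚ) • ∑ d, γ d := by
      rw [Finset.sum_congr rfl (fun c _ => hγ' c), Finset.sum_comm, Finset.smul_sum]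
      refine Finset.sum_congr rfl fun d _ => ?_
      rw [← Finset.sum_smul, cnt_sum]
    have h2 : ∑ c, α' c = (1 / (p:ℚ)) • (1 : I → ℝ) - (ε * (T + 1)) • (1 : I → ℝ) := by
      have h3 := hrsum (fun _ => 1)
      simp only [mul_one] at h3
      simp only [hα']
      rw [Finset.sum_sub_distrib, ← Finset.sum_smul, ← Finset.mul_sum, h3, S.alpha_sum hp st hst eqm]
      congr 3; ring
    have h4 : (1 / (p:ℚ)) - ε * (T + 1) = L * ε := by
      have : (q:ℚ) = T + L + 1 := by rw [hq]; push_cast; ring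
      rw [hε]; field_simp; rw [this]; ring
    rw [← sub_smul, h4, h1, ← smul_smul] at h2
    have hLne : (L:ℚ) ≠ 0 := by exact_mod_cast (by omega : L ≠ 0)
    exact smul_right_injective _ hLne h2
  -- words
  let W : Fin s' → ℕ → C := fun d => wd k T L (dM F L (e.symm d).1) d cs c2 (dX F cs (e.symm d).1)
    (dY F cs (e.symm d).1)
  have hWsum : ∀ d, ∀ G : C → ℚ, ∑ j ∈ Finset.range q, G (W d j) =
      ((T : ℚ) - 2) * G cs + 3 * G c2 + dM F L (e.symm d).1 * G (dX F cs (e.symm d).1) +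
        ((L : ℚ) - dM F L (e.symm d).1) * G (dY F cs (e.symm d).1) := by
    intro d G
    exact wd_sum k T L _ d _ _ _ _ (by have := d.2; omega) (dM_le F L hL hL2 _) G
  obtain ⟨t, ht, ht1, ht2⟩ := S.lift (ι := Fin s' × Fin q × Fin p) st hst
    (fun j => (W j.1 j.2.1, j.2.2)) (fun j => (1 / 2 : ℚ) • γ (e.symm j.1).1)
    (fun j => (hγ _).smul _ (by norm_num))
    (by
      rintro ⟨c, i⟩
      rw [eqm c i z]
      change _ = α c
      rw [Finset.sum_filter, Fintype.sum_prod_type]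
      have h1 : ∀ d, ∑ y : Fin q × Fin p, (if (W d y.1, y.2) = (c, i) then (1 / 2 : ℚ) • γ (e.symm d).1 else 0)
          = ((1 / 2 : ℚ) * (rr c + cnt F cs L (e.symm d).1 c)) • γ (e.symm d).1 := by
        intro d
        rw [Fintype.sum_prod_type]
        have h2 : ∀ b : Fin q, ∑ y : Fin p, (if (W d b, y) = (c, i) then (1 / 2 : ℚ) • γ (e.symm d).1 else 0)
            = (if W d b = c then (1:ℚ) else 0) • (1 / 2 : ℚ) • γ (e.symm d).1 := by
          intro b
          by_cases h : W d b = c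
          · simp [h]
          · simp [h]
        rw [Finset.sum_congr rfl (fun b _ => h2 b), ← Finset.sum_smul, smul_smul, mul_comm (1/2 : ℚ)]
        congr 2
        rw [Fin.sum_univ_eq_sum_range (fun b => if W d b = c then (1:ℚ) else 0) q,
          hWsum d (fun x => if x = c then (1:ℚ) else 0)]
        simp only [cnt, hrr, mul_ite, mul_one, mul_zero]
        ring
      refine (Finset.sum_congr rfl (fun d _ => (Finset.sum_congr rfl fun y _ => by congr).trans (h1 d))).trans ?_
      rw [Equiv.sum_comp e.symm (fun d => ((1 / 2 : ℚ) * (rr c + cnt F cs L d.1 c)) • γ d.1),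
        Fintype.sum_prod_type]
      have h3 : ∀ d : C × C, ∑ _y : Bool, ((1 / 2 : ℚ) * (rr c + cnt F cs L d c)) • γ d
          = rr c • γ d + cnt F cs L d c • γ d := by
        intro d
        rw [Fintype.sum_bool, ← add_smul, ← add_smul]; congr 1; ring
      rw [Finset.sum_congr rfl (fun d _ => h3 d), Finset.sum_add_distrib, ← hγ' c, ← Finset.smul_sum,
        hsumγ, smul_smul]
      simp only [hα']
      rw [mul_comm]; abel)
  refine ⟨s', q, W, cs, t, by omega, ht, ht1, ?_, ?_, ?_, ?_, ?_⟩
  · intro d b b' i i'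
    rw [ht2, ht2]
  · intro d
    have := d.2
    constructor
    · simp only [W, wd]
      rw [if_pos (by omega), if_neg (by omega)]
    · simp only [W, wd]
      rw [if_neg (by omega), if_neg (by omega)]
  · have := wd_recog k T L (fun d : Fin s' => dM F L (e.symm d).1) (fun d => (d : ℕ)) Fin.val_injective
      (ν cs) (ν c2) (fun d => ν (dX F cs (e.symm d).1)) (fun d => ν (dY F cs (e.symm d).1))
      (fun h => hc2 h.symm) (by omega) (fun d => by have := d.2; omega) (by omega)
      (fun d => (dM_run F L hL hL2 _).1) (fun d => (dM_run F L hL hL2 _).2)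
    convert this using 3
    exact wd_map ν _ _ _ _ _ _ _ _ _ _
  · intro d
    have h1 := hWsum d (fun c => (F c : ℚ))
    have h2 := d_weight F cs L hL hL2 hcs (e.symm d).1
    have h3 : ∑ b ∈ Finset.range q, F (W d b) = ((T : ℤ) - 2) * F cs + 3 * F c2 +
      (dM F L (e.symm d).1 * F (dX F cs (e.symm d).1) +
        ((L : ℤ) - dM F L (e.symm d).1) * F (dY F cs (e.symm d).1)) := by
      have h5 : ((∑ b ∈ Finset.range q, F (W d b) : ℤ) : ℚ) = ∑ b ∈ Finset.range q, (F (W d b) : ℚ) :=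
        Int.cast_sum _ _
      rw [h1] at h5
      rw [← Int.cast_inj (α := ℚ), h5]
      push_cast; ring
    rw [h3]
    have h4 : 0 ≤ ((T : ℤ) - 2) * F cs + 3 * F c2 := by
      have : (T:ℤ) - 2 ≥ 3 * (F c2).natAbs := by omega
      have : ((F c2).natAbs : ℤ) ≥ - F c2 := by omega
      nlinarith
    linarith
  · obtain ⟨d, hd⟩ : ∃ d, γ d ≠ 0 := by
      by_contra hcon
      push Not at hcon
      simp only [hcon, Finset.sum_const_zero] at hsumγ
      have := congrFun hsumγ i0
      simp [Rat.smul_def] at this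
      exact hε0.ne (by exact_mod_cast this)
    have hq0 : 0 < q := by omega
    have hne : ∀ β : Bool, ∃ x, t x = (e (d, β), ⟨0, hq0⟩, z) := by
      intro β
      by_contra hcon
      have h1 : {x | t x = (e (d, β), (⟨0, hq0⟩ : Fin q), z)} = ∅ := by
        ext x; simp only [mem_ofPred_eq, mem_empty_iff_false, iff_false]; exact fun h => hcon ⟨x, h⟩
      have h2 := ht2 (e (d, β), (⟨0, hq0⟩ : Fin q), z)
      rw [h1, S.empty] at h2
      simp only [Equiv.symm_apply_apply] at h2
      exact hd ((smul_eq_zero.1 h2.symm).resolve_left (by norm_num))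
    obtain ⟨x, hx⟩ := hne true
    obtain ⟨x', hx'⟩ := hne false
    refine ⟨x, x', ?_⟩
    rw [hx, hx']; simp
end
end ToeplitzProof

namespace ToeplitzProof
section
variable {X I : Type*} [TopologicalSpace X] {ev : Set X → I → ℝ}

/-- a Kakutani–Rokhlin type partition with towers of the same height -/
structure Stage {X I : Type*} [TopologicalSpace X] (ev : Set X → I → ℝ) where
  s : ℕ
  p : ℕ
  hp : 0 < p
  col : X → Fin s
  pos : X → ℕ
  pos_lt : ∀ x, pos x < p
  lc_col : IsLocallyConstant col
  lc_pos : IsLocallyConstant pos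
  eqm : ∀ c i j, i < p → j < p → ev {x | col x = c ∧ pos x = i} = ev {x | col x = c ∧ pos x = j}
  two : ∃ x x', col x ≠ col x'

/-- the relation between two successive stages -/
def Link (J : (X → ℤ) → I → ℝ) (A B : Stage ev) (f : X → ℤ) (q : ℕ)
    (w : Fin B.s → ℕ → Fin A.s) (c0 : Fin A.s) : Prop :=
  2 ≤ q ∧ B.p = A.p * q ∧ (∀ x, A.pos x = B.pos x % A.p) ∧
    (∀ x, A.col x = w (B.col x) (B.pos x / A.p)) ∧ (∀ d, w d 0 = c0 ∧ w d (q - 1) = c0) ∧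
    Recog w q ∧ ∃ fv : Fin B.s → ℕ → ℤ, (∀ x, f x = fv (B.col x) (B.pos x)) ∧
      ((∀ i, 0 < J f i) → ∀ d, 0 ≤ ∑ j ∈ Finset.range B.p, fv d j)

theorem sum_range_mul_block (p q : ℕ) (g : ℕ → ℤ) :
    ∑ j ∈ Finset.range (p * q), g j = ∑ b ∈ Finset.range q, ∑ i ∈ Finset.range p, g (p * b + i) := by
  induction q with
  | zero => simp
  | succ q ih => rw [Nat.mul_succ, Finset.sum_range_add, ih, Finset.sum_range_succ]

theorem lc_comp {Y Z : Type*} {t : X → Y} (ht : IsLocallyConstant t) (g : Y → Z) :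
    IsLocallyConstant (fun x => g (t x)) := ht.comp g

theorem EvSys.step (S : EvSys ev) [CompactSpace X] (J : (X → ℤ) → I → ℝ)
    (hJ : ∀ (ι : Type) (_ : Fintype ι) (t : X → ι), IsLocallyConstant t → ∀ (fv : ι → ℤ) (i : I),
      J (fun x => fv (t x)) i = ∑ j, (fv j : ℝ) * ev {x | t x = j} i)
    (A : Stage ev) (f : X → ℤ) (hf : IsLocallyConstant f) :
    ∃ (B : Stage ev) (q : ℕ) (w : Fin B.s → ℕ → Fin A.s) (c0 : Fin A.s), Link J A B f q w c0 := by
  classical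
  have hfin : Finite (range f) := hf.range_finite
  have : Fintype (range f) := Fintype.ofFinite _
  have hp := A.hp
  have hst : IsLocallyConstant (fun x => (A.col x, (⟨A.pos x, A.pos_lt x⟩ : Fin A.p))) := by
    have h1 := A.lc_col.prodMk A.lc_pos
    have := h1.comp (fun y : Fin A.s × ℕ => (y.1, (⟨y.2 % A.p, Nat.mod_lt _ hp⟩ : Fin A.p)))
    convert this using 1
    funext x
    simp [Nat.mod_eq_of_lt (A.pos_lt x)]
  have hset : ∀ c (i : Fin A.p), {x | (A.col x, (⟨A.pos x, A.pos_lt x⟩ : Fin A.p)) = (c, i)} =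
      {x | A.col x = c ∧ A.pos x = i} := by
    intro c i; ext x; simp [Prod.ext_iff, Fin.ext_iff]
  have hf' : IsLocallyConstant (fun x => (⟨f x, x, rfl⟩ : range f)) := by
    rw [IsLocallyConstant.iff_exists_open]
    intro x
    obtain ⟨U, hU, hx, h⟩ := hf.exists_open x
    exact ⟨U, hU, hx, fun y hy => Subtype.ext (h y hy)⟩
  obtain ⟨st1, hst1, e1, e2, eqm1⟩ := S.refine hp _ hst
    (fun c i j => by rw [hset, hset]; exact A.eqm c i j i.2 j.2) _ hf'
  set Fc : (Fin A.s × (Fin A.p → range f)) → ℤ :=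
    fun c => if (∀ i, 0 < J f i) then ∑ j, (c.2 j : ℤ) else 1 with hFc
  have hF : ∀ i, 0 < ∑ c, (Fc c : ℝ) * ev {x | st1 x = (c, (⟨0, hp⟩ : Fin A.p))} i := by
    intro i
    by_cases h : ∀ i, 0 < J f i
    · have h1 := hJ _ inferInstance st1 hst1 (fun y => (y.1.2 y.2 : ℤ)) i
      have h2 : (fun x => ((st1 x).1.2 (st1 x).2 : ℤ)) = f := by
        funext x; rw [e2]
      rw [h2] at h1
      have h3 := h i
      rw [h1, Fintype.sum_prod_type] at h3
      refine h3.trans_eq (Finset.sum_congr rfl fun c _ => ?_)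
      simp only [hFc, h, implies_true, if_true]
      push_cast
      rw [Finset.sum_mul]
      refine Finset.sum_congr rfl fun j _ => ?_
      rw [eqm1 c j ⟨0, hp⟩]
    · simp only [hFc, h, if_false]
      have h1 := congrFun (S.alpha_sum hp st1 hst1 eqm1) i
      rw [Finset.sum_apply] at h1
      simp only [Int.cast_one, one_mul]
      rw [h1]
      have : (0:ℝ) < A.p := by exact_mod_cast hp
      simp [Rat.smul_def, this]
  obtain ⟨s', q, w, c0, t, hq, ht, t1, t2, t3, t4, t5, t6⟩ := S.growth hp st1 hst1 eqm1
    (fun c => c.1) (by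
      obtain ⟨x, x', h⟩ := A.two
      refine ⟨x, x', ?_⟩
      have h1 := e1 x; have h2 := e1 x'
      simp only [Prod.ext_iff] at h1 h2
      rw [h1.1, h2.1]; exact h) Fc hF
  have tt : ∀ x, (w (t x).1 (t x).2.1).1 = A.col x ∧ ((t x).2.2 : ℕ) = A.pos x ∧
      ((w (t x).1 (t x).2.1).2 (t x).2.2 : ℤ) = f x := by
    intro x
    have h1 := t1 x
    have h2 := e1 x
    have h3 := e2 x
    rw [← h1] at h2 h3
    simp only [Prod.ext_iff, Fin.ext_iff] at h2
    exact ⟨Fin.ext h2.1, h2.2, congrArg Subtype.val h3⟩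
  have hdiv : ∀ (b : Fin q) (i : Fin A.p), ((i : ℕ) + A.p * b) / A.p = b := by
    intro b i
    rw [Nat.add_mul_div_left _ _ hp, Nat.div_eq_of_lt i.2, zero_add]
  have hmod : ∀ (b : Fin q) (i : Fin A.p), ((i : ℕ) + A.p * b) % A.p = i := by
    intro b i
    rw [Nat.add_mul_mod_self_left, Nat.mod_eq_of_lt i.2]
  have hset2 : ∀ d (j : ℕ) (h : j < A.p * q), {x | (t x).1 = d ∧ ((t x).2.2 : ℕ) + A.p * (t x).2.1 = j} =
      {x | t x = (d, ⟨j / A.p, Nat.div_lt_of_lt_mul h⟩, ⟨j % A.p, Nat.mod_lt _ hp⟩)} := by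
    intro d j h
    ext x
    simp only [mem_ofPred_eq, Prod.ext_iff, Fin.ext_iff]
    constructor
    · rintro ⟨h1, h2⟩
      refine ⟨h1, ?_, ?_⟩
      · rw [← h2, hdiv]
      · rw [← h2, hmod]
    · rintro ⟨h1, h2, h3⟩
      refine ⟨h1, ?_⟩
      rw [h2, h3, Nat.mod_add_div]
  refine ⟨⟨s', A.p * q, Nat.mul_pos hp (by omega), fun x => (t x).1,
    fun x => ((t x).2.2 : ℕ) + A.p * (t x).2.1, ?_, ?_, ?_, ?_, t6⟩, q, fun d j => (w d j).1, c0.1,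
    hq, rfl, ?_, ?_, ?_, t4, ?_⟩
  · intro x
    have h1 := (t x).2.2.2
    have h2 := (t x).2.1.2
    calc ((t x).2.2 : ℕ) + A.p * (t x).2.1 < A.p + A.p * (t x).2.1 := by omega
      _ = A.p * ((t x).2.1 + 1) := by ring
      _ ≤ A.p * q := Nat.mul_le_mul_left _ h2
  · exact lc_comp ht (fun y => y.1)
  · exact lc_comp ht (fun y => ((y.2.2 : ℕ) + A.p * y.2.1))
  · intro c i j hi hj
    rw [hset2 c i hi, hset2 c j hj]
    exact t2 _ _ _ _ _
  · intro x
    show A.pos x = (((t x).2.2 : ℕ) + A.p * (t x).2.1) % A.p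
    rw [hmod, (tt x).2.1]
  · intro x
    show A.col x = (w (t x).1 ((((t x).2.2 : ℕ) + A.p * (t x).2.1) / A.p)).1
    rw [hdiv, (tt x).1]
  · intro d
    exact ⟨congrArg Prod.fst (t3 d).1, congrArg Prod.fst (t3 d).2⟩
  · refine ⟨fun d j => ((w d (j / A.p)).2 ⟨j % A.p, Nat.mod_lt _ hp⟩ : ℤ), ?_, ?_⟩
    · intro x
      simp only [hdiv, hmod, Fin.eta]
      exact (tt x).2.2.symm
    · intro h d
      have h1 := t5 d
      show 0 ≤ ∑ j ∈ Finset.range (A.p * q), _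
      rw [sum_range_mul_block]
      refine h1.trans_eq (Finset.sum_congr rfl fun b _ => ?_)
      simp only [hFc, h, implies_true, if_true]
      rw [← Fin.sum_univ_eq_sum_range (fun i => ((w d ((A.p * b + i) / A.p)).2 ⟨(A.p * b + i) % A.p, Nat.mod_lt _ hp⟩ : ℤ))]
      refine Finset.sum_congr rfl fun j _ => ?_
      have a1 : (A.p * b + j) / A.p = b := by
        rw [Nat.mul_add_div hp, Nat.div_eq_of_lt j.2, add_zero]
      have a2 : (A.p * b + j) % A.p = j := by
        rw [Nat.mul_add_mod, Nat.mod_eq_of_lt j.2]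
      simp only [a1, a2, Fin.eta]

theorem EvSys.base (S : EvSys ev) : ∃ A : Stage ev, A.s = 2 ∧ A.p = 1 := by
  classical
  obtain ⟨V, hV, -, hV2⟩ := S.div Set.univ isClopen_univ 2 (by norm_num)
  obtain ⟨i0⟩ := S.ne
  have h1 : V.Nonempty := by
    by_contra h
    rw [not_nonempty_iff_eq_empty] at h
    have := hV2 i0
    rw [h, S.empty, S.univ] at this
    norm_num at this
  have h2 : Vᶜ.Nonempty := by
    by_contra h
    rw [not_nonempty_iff_eq_empty, compl_empty_iff] at h
    have := hV2 i0
    rw [h, S.univ] at this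
    norm_num at this
  refine ⟨⟨2, 1, one_pos, fun x => if x ∈ V then 1 else 0, fun _ => 0, fun _ => one_pos, ?_,
    IsLocallyConstant.const 0, ?_, ?_⟩, rfl, rfl⟩
  · rw [IsLocallyConstant.iff_exists_open]
    intro x
    by_cases hx : x ∈ V
    · exact ⟨V, hV.2, hx, fun y hy => by simp [hx, hy]⟩
    · exact ⟨Vᶜ, hV.compl.2, hx, fun y hy => by simp [hx, show y ∉ V from hy]⟩
  · intro c i j hi hj
    obtain rfl : i = 0 := by omega
    obtain rfl : j = 0 := by omega
    rfl
  · obtain ⟨x, hx⟩ := h1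
    obtain ⟨x', hx'⟩ := h2
    exact ⟨x, x', by simp [hx, show x' ∉ V from hx']⟩
end
end ToeplitzProof

namespace ToeplitzProof

/-- a nested sequence of equal height tower partitions -/
structure Tower (X : Type*) [TopologicalSpace X] where
  s : ℕ → ℕ
  p : ℕ → ℕ
  q : ℕ → ℕ
  col : ∀ n, X → Fin (s n)
  pos : ℕ → X → ℕ
  w : ∀ n, Fin (s (n + 1)) → ℕ → Fin (s n)
  c0 : ∀ n, Fin (s n)
  hp0 : p 0 = 1
  hp : ∀ n, 0 < p n
  hq : ∀ n, 2 ≤ q n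
  hpq : ∀ n, p (n + 1) = p n * q n
  pos_lt : ∀ n x, pos n x < p n
  lc_col : ∀ n, IsLocallyConstant (col n)
  lc_pos : ∀ n, IsLocallyConstant (pos n)
  pos_link : ∀ n x, pos n x = pos (n + 1) x % p n
  col_link : ∀ n x, col n x = w n (col (n + 1) x) (pos (n + 1) x / p n)
  w0 : ∀ n d, w n d 0 = c0 n
  wl : ∀ n d, w n d (q n - 1) = c0 n
  recog : ∀ n, Recog (w n) (q n)
  full : ∀ n x j, j < p n → ∃ y, col n y = col n x ∧ pos n y = j
  sep : ∀ x y, (∀ n, col n x = col n y ∧ pos n x = pos n y) → x = y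

namespace Tower
variable {X : Type*} [TopologicalSpace X] (A : Tower X)

/-- `y` is a successor of `x` at level `n` -/
def Succ (n : ℕ) (x y : X) : Prop :=
  (A.pos n x + 1 < A.p n → A.pos n y = A.pos n x + 1 ∧ A.col n y = A.col n x) ∧
    (A.pos n x + 1 = A.p n → A.pos n y = 0)

theorem top_pos (n : ℕ) (x : X) (h : A.pos (n + 1) x + 1 = A.p (n + 1)) :
    A.pos n x + 1 = A.p n ∧ A.pos (n + 1) x / A.p n = A.q n - 1 := by
  have h1 := A.hp n
  have h2 := A.hq n
  have h3 : A.pos (n + 1) x = (A.p n - 1) + A.p n * (A.q n - 1) := by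
    obtain ⟨a, ha⟩ : ∃ a, A.p n = a + 1 := ⟨A.p n - 1, by omega⟩
    obtain ⟨b, hb⟩ : ∃ b, A.q n = b + 1 := ⟨A.q n - 1, by omega⟩
    have h5 : A.p n * A.q n = (a + 1) * b + (a + 1) := by rw [ha, hb]; ring
    have h6 : A.p n * (A.q n - 1) = (a + 1) * b := by rw [ha, hb]; simp
    have h4 := A.hpq n
    omega
  constructor
  · rw [A.pos_link, h3, Nat.add_mul_mod_self_left, Nat.mod_eq_of_lt (by omega)]; omega
  · rw [h3, Nat.add_mul_div_left _ _ h1, Nat.div_eq_of_lt (by omega), zero_add]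

theorem succ_down (n : ℕ) (x y : X) (h : A.Succ (n + 1) x y) : A.Succ n x y := by
  have hp := A.hp n
  have hx := A.pos_lt (n + 1) x
  rcases Nat.lt_or_ge (A.pos (n + 1) x + 1) (A.p (n + 1)) with h1 | h1
  · obtain ⟨h2, h3⟩ := h.1 h1
    have e1 := A.pos_link n x
    have e2 := A.pos_link n y
    have e3 := A.col_link n x
    have e4 := A.col_link n y
    rw [h2] at e2 e4
    rw [h3] at e4
    constructor
    · intro h4
      have e5 := Nat.div_add_mod (A.pos (n + 1) x) (A.p n)
      rw [← e1] at e5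
      have e6 : A.pos (n + 1) x + 1 = (A.pos n x + 1) + A.p n * (A.pos (n + 1) x / A.p n) := by omega
      rw [e6, Nat.add_mul_mod_self_left, Nat.mod_eq_of_lt h4] at e2
      rw [e6, Nat.add_mul_div_left _ _ hp, Nat.div_eq_of_lt h4, zero_add] at e4
      exact ⟨e2, e4.trans e3.symm⟩
    · intro h4
      rw [e2, Nat.add_mod, ← e1]
      rcases Nat.lt_or_ge 1 (A.p n) with h5 | h5
      · rw [Nat.mod_eq_of_lt h5, h4, Nat.mod_self]
      · have : A.p n = 1 := by omega
        rw [this, Nat.mod_one]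
  · have h2 : A.pos (n + 1) x + 1 = A.p (n + 1) := by omega
    have h3 := h.2 h2
    have h4 := (A.top_pos n x h2).1
    constructor
    · intro h5; omega
    · intro _; rw [A.pos_link, h3, Nat.zero_mod]

theorem clopen_right (n : ℕ) (x : X) : IsClopen {y | A.Succ n x y} := by
  have h := (A.lc_col n).prodMk (A.lc_pos n)
  exact clopen_pred h (fun z => (A.pos n x + 1 < A.p n → z.2 = A.pos n x + 1 ∧ z.1 = A.col n x) ∧
    (A.pos n x + 1 = A.p n → z.2 = 0))

theorem clopen_left (n : ℕ) (y : X) : IsClopen {x | A.Succ n x y} := by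
  have h := (A.lc_col n).prodMk (A.lc_pos n)
  exact clopen_pred h (fun z => (z.2 + 1 < A.p n → A.pos n y = z.2 + 1 ∧ A.col n y = z.1) ∧
    (z.2 + 1 = A.p n → A.pos n y = 0))

theorem exists_right [CompactSpace X] (x : X) : ∃ y, ∀ n, A.Succ n x y := by
  obtain ⟨y, hy⟩ := IsCompact.nonempty_iInter_of_sequence_nonempty_isCompact_isClosed
    (fun n => {y | A.Succ n x y}) (fun n y hy => A.succ_down n x y hy)
    (fun n => by
      by_cases h : A.pos n x + 1 < A.p n
      · obtain ⟨y, h1, h2⟩ := A.full n x _ h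
        exact ⟨y, fun _ => ⟨h2, h1⟩, fun h' => by omega⟩
      · obtain ⟨y, h1, h2⟩ := A.full n x 0 (A.hp n)
        exact ⟨y, fun h' => absurd h' h, fun _ => h2⟩)
    (A.clopen_right 0 x).1.isCompact (fun n => (A.clopen_right n x).1)
  exact ⟨y, fun n => mem_iInter.1 hy n⟩

theorem exists_left [CompactSpace X] (y : X) : ∃ x, ∀ n, A.Succ n x y := by
  obtain ⟨x, hx⟩ := IsCompact.nonempty_iInter_of_sequence_nonempty_isCompact_isClosed
    (fun n => {x | A.Succ n x y}) (fun n x hx => A.succ_down n x y hx)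
    (fun n => by
      have hp := A.hp n
      have hy := A.pos_lt n y
      by_cases h : A.pos n y = 0
      · obtain ⟨x, h1, h2⟩ := A.full n y (A.p n - 1) (by omega)
        exact ⟨x, fun h' => by omega, fun _ => h⟩
      · obtain ⟨x, h1, h2⟩ := A.full n y (A.pos n y - 1) (by omega)
        exact ⟨x, fun _ => ⟨by omega, h1.symm⟩, fun h' => by omega⟩)
    (A.clopen_left 0 y).1.isCompact (fun n => (A.clopen_left n y).1)
  exact ⟨x, fun n => mem_iInter.1 hx n⟩

theorem col_zero (n : ℕ) (y : X) (h : A.pos (n + 1) y = 0) : A.col n y = A.c0 n := by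
  rw [A.col_link, h, Nat.zero_div, A.w0]

theorem col_top (n : ℕ) (y : X) (h : A.pos (n + 1) y + 1 = A.p (n + 1)) : A.col n y = A.c0 n := by
  rw [A.col_link, (A.top_pos n y h).2, A.wl]

theorem unique_right (x y y' : X) (h : ∀ n, A.Succ n x y) (h' : ∀ n, A.Succ n x y') : y = y' := by
  refine A.sep y y' fun n => ?_
  have hpos : ∀ n, A.pos n y = A.pos n y' := by
    intro n
    have := A.pos_lt n x
    by_cases h1 : A.pos n x + 1 < A.p n
    · rw [((h n).1 h1).1, ((h' n).1 h1).1]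
    · rw [(h n).2 (by omega), (h' n).2 (by omega)]
  refine ⟨?_, hpos n⟩
  have := A.pos_lt (n + 1) x
  by_cases h1 : A.pos (n + 1) x + 1 < A.p (n + 1)
  · rw [A.col_link n y, A.col_link n y', ((h (n+1)).1 h1).2, ((h' (n+1)).1 h1).2, hpos]
  · rw [A.col_zero n y ((h (n+1)).2 (by omega)), A.col_zero n y' ((h' (n+1)).2 (by omega))]

theorem unique_left (x x' y : X) (h : ∀ n, A.Succ n x y) (h' : ∀ n, A.Succ n x' y) : x = x' := by
  have key : ∀ x, (∀ n, A.Succ n x y) → ∀ n, (A.pos n y = 0 → A.pos n x + 1 = A.p n) ∧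
      (0 < A.pos n y → A.pos n x + 1 = A.pos n y ∧ A.col n x = A.col n y) := by
    intro x h n
    have := A.pos_lt n x
    by_cases h1 : A.pos n x + 1 < A.p n
    · have h2 := (h n).1 h1
      exact ⟨fun h3 => by omega, fun _ => ⟨h2.1.symm, h2.2.symm⟩⟩
    · have h2 := (h n).2 (by omega)
      exact ⟨fun h3 => by omega, fun _ => by omega⟩
  refine A.sep x x' fun n => ?_
  have hpos : ∀ n, A.pos n x = A.pos n x' := by
    intro n
    rcases Nat.eq_zero_or_pos (A.pos n y) with h1 | h1
    · have := (key x h n).1 h1; have := (key x' h' n).1 h1; omega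
    · have := (key x h n).2 h1; have := (key x' h' n).2 h1; omega
  refine ⟨?_, hpos n⟩
  rcases Nat.eq_zero_or_pos (A.pos (n + 1) y) with h1 | h1
  · rw [A.col_top n x ((key x h (n + 1)).1 h1), A.col_top n x' ((key x' h' (n + 1)).1 h1)]
  · rw [A.col_link n x, A.col_link n x', hpos, ((key x h (n+1)).2 h1).2, ((key x' h' (n+1)).2 h1).2]

theorem exists_homeo [CompactSpace X] [T2Space X] : ∃ φ : X ≃ₜ X, ∀ x n, A.Succ n x (φ x) := by
  choose f hf using A.exists_right
  choose g hg using A.exists_left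
  have hcont : Continuous f := by
    have hgr : IsClosed {z : X × X | ∀ n, A.Succ n z.1 z.2} := by
      rw [Set.ofPred_forall]
      refine isClosed_iInter fun n => ?_
      have h := (A.lc_col n).prodMk (A.lc_pos n)
      have h2 : IsLocallyConstant (fun z : X × X => ((A.col n z.1, A.pos n z.1), (A.col n z.2, A.pos n z.2))) :=
        (h.comp_continuous continuous_fst).prodMk (h.comp_continuous continuous_snd)
      exact (clopen_pred h2 (fun z =>
        (z.1.2 + 1 < A.p n → z.2.2 = z.1.2 + 1 ∧ z.2.1 = z.1.1) ∧ (z.1.2 + 1 = A.p n → z.2.2 = 0))).1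
    rw [continuous_iff_isClosed]
    intro F hF
    have : f ⁻¹' F = Prod.fst '' ({z : X × X | ∀ n, A.Succ n z.1 z.2} ∩ Prod.snd ⁻¹' F) := by
      ext x
      simp only [mem_preimage, mem_image, mem_inter_iff, mem_ofPred_eq, Prod.exists, exists_and_right,
        exists_eq_right]
      constructor
      · intro h; exact ⟨f x, hf x, h⟩
      · rintro ⟨y, h1, h2⟩
        rwa [A.unique_right x _ _ (hf x) h1]
    rw [this]
    exact isClosedMap_fst_of_compactSpace _ (hgr.inter (hF.preimage continuous_snd))
  let e : X ≃ X := ⟨f, g, fun x => A.unique_left _ _ _ (hg (f x)) (hf x),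
    fun y => A.unique_right _ _ _ (hf (g y)) (hg y)⟩
  exact ⟨Continuous.homeoOfEquivCompactToT2 (f := e) hcont, hf⟩

section orbit
variable (Φ : Equiv.Perm X)

theorem pos_succ (hΦ : ∀ x n, A.Succ n x (Φ x))
    (n : ℕ) (x : X) : (A.pos n (Φ x) : ℤ) = ((A.pos n x : ℤ) + 1) % A.p n := by
  have hlt := A.pos_lt n x
  by_cases h : A.pos n x + 1 < A.p n
  · rw [((hΦ x n).1 h).1, Int.emod_eq_of_lt (by positivity) (by exact_mod_cast h)]; push_cast; rfl
  · have h2 : A.pos n x + 1 = A.p n := by omega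
    rw [(hΦ x n).2 h2, ← h2]; push_cast; simp

theorem pos_zpow (hΦ : ∀ x n, A.Succ n x (Φ x))
    (n : ℕ) (x : X) (z : ℤ) :
    (A.pos n ((Φ ^ z) x) : ℤ) = ((A.pos n x : ℤ) + z) % A.p n := by
  have hmod : ∀ y, ((A.pos n y : ℤ)) % A.p n = A.pos n y := fun y =>
    Int.emod_eq_of_lt (by positivity) (by exact_mod_cast A.pos_lt n y)
  induction z using Int.induction_on with
  | zero => simp [hmod]
  | succ z ih =>
    rw [add_comm (z:ℤ) 1, zpow_add, zpow_one, Equiv.Perm.mul_apply, A.pos_succ Φ hΦ, ih]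
    rw [Int.emod_add_emod]; ring_nf
  | pred z ih =>
    have h1 := A.pos_succ Φ hΦ n ((Φ ^ (-(z:ℤ) - 1)) x)
    rw [← Equiv.Perm.mul_apply, ← zpow_one_add, show 1 + (-(z:ℤ) - 1) = -z by ring, ih] at h1
    rw [← hmod]
    have h2 : ((A.pos n x : ℤ) + -z) ≡ (A.pos n ((Φ ^ (-(z:ℤ) - 1)) x) : ℤ) + 1 [ZMOD A.p n] := h1
    have h3 := h2.sub_right 1
    rw [add_sub_cancel_right] at h3
    rw [h3.symm.eq]
    ring_nf

theorem col_pow (hΦ : ∀ x n, A.Succ n x (Φ x))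
    (n : ℕ) (x : X) (m : ℕ) (h : A.pos n x + m < A.p n) :
    A.col n ((Φ ^ m) x) = A.col n x ∧ A.pos n ((Φ ^ m) x) = A.pos n x + m := by
  induction m with
  | zero => simp
  | succ m ih =>
    have h1 := ih (by omega)
    rw [pow_succ', Equiv.Perm.mul_apply]
    have h2 := (hΦ ((Φ ^ m) x) n).1 (by omega)
    exact ⟨h2.2.trans h1.1, by omega⟩

theorem col_zpow (hΦ : ∀ x n, A.Succ n x (Φ x))
    (n : ℕ) (x : X) (z : ℤ) (h0 : 0 ≤ A.pos n x + z) (h1 : A.pos n x + z < A.p n) :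
    A.col n ((Φ ^ z) x) = A.col n x ∧ (A.pos n ((Φ ^ z) x) : ℤ) = A.pos n x + z := by
  have hpos : (A.pos n ((Φ ^ z) x) : ℤ) = A.pos n x + z := by
    rw [A.pos_zpow Φ hΦ, Int.emod_eq_of_lt h0 h1]
  refine ⟨?_, hpos⟩
  rcases le_total 0 z with hz | hz
  · obtain ⟨m, rfl⟩ := Int.eq_ofNat_of_zero_le hz
    have := A.col_pow Φ hΦ n x m (by exact_mod_cast h1)
    simpa using this.1
  · obtain ⟨m, hm⟩ := Int.eq_ofNat_of_zero_le (neg_nonneg.2 hz)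
    have hlt := A.pos_lt n x
    have := A.col_pow Φ hΦ n ((Φ ^ z) x) m (by omega)
    rw [← zpow_natCast, ← Equiv.Perm.mul_apply, ← zpow_add, ← hm] at this
    simpa using this.1.symm
end orbit
end Tower
end ToeplitzProof

namespace ToeplitzProof
namespace Tower
variable {X : Type*} [TopologicalSpace X] (A : Tower X)
variable (Φ : Equiv.Perm X)

theorem col_word (hΦ : ∀ x n, A.Succ n x (Φ x))
    (n : ℕ) (y : X) (z : ℤ) (j : ℕ) (hj : j < A.q n)
    (h : (A.pos (n + 1) y : ℤ) + z = A.p n * j) :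
    A.col n ((Φ ^ z) y) = A.w n (A.col (n + 1) y) j := by
  have hp := A.hp n
  have h2 : (A.p n * j : ℤ) < A.p (n + 1) := by
    rw [A.hpq]; push_cast
    exact mul_lt_mul_of_pos_left (by exact_mod_cast hj) (by exact_mod_cast hp)
  have h1 := A.col_zpow Φ hΦ (n + 1) y z (by rw [h]; positivity) (by rw [h]; exact h2)
  have h3 : A.pos (n + 1) ((Φ ^ z) y) = A.p n * j := by
    have := h1.2.trans h
    exact_mod_cast this
  rw [A.col_link, h1.1, h3, Nat.mul_div_cancel_left _ hp]

theorem code_inj_aux (hΦ : ∀ x n, A.Succ n x (Φ x))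
    (n : ℕ) : ∀ x x' : X, (∀ z : ℤ, A.col 0 ((Φ ^ z) x) = A.col 0 ((Φ ^ z) x')) →
    A.col n x = A.col n x' ∧ A.pos n x = A.pos n x' := by
  induction n with
  | zero =>
    intro x x' h
    refine ⟨by simpa using h 0, ?_⟩
    have h1 := A.pos_lt 0 x
    have h2 := A.pos_lt 0 x'
    rw [A.hp0] at h1 h2; omega
  | succ n ih =>
    intro x x' h
    have hz : ∀ z : ℤ, A.col n ((Φ ^ z) x) = A.col n ((Φ ^ z) x') ∧
        A.pos n ((Φ ^ z) x) = A.pos n ((Φ ^ z) x') := by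
      intro z
      refine ih _ _ fun z' => ?_
      rw [← Equiv.Perm.mul_apply, ← Equiv.Perm.mul_apply, ← zpow_add]
      exact h _
    obtain ⟨a, b, k, hab, hk1, hk2, hk3, hk4, e, he⟩ := A.recog n
    have hp := A.hp n
    have hpos : A.pos (n + 1) x = A.pos (n + 1) x' := by
      set z : ℤ := A.p n * k - A.pos (n + 1) x with hzdef
      set y := (Φ ^ z) x with hy
      set y' := (Φ ^ z) x' with hy'
      have hzy : ∀ z' : ℤ, A.col n ((Φ ^ z') y) = A.col n ((Φ ^ z') y') := by
        intro z'
        rw [hy, hy', ← Equiv.Perm.mul_apply, ← Equiv.Perm.mul_apply, ← zpow_add]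
        exact (hz _).1
      have hkq : (A.p n * k : ℤ) < A.p (n + 1) := by
        rw [A.hpq]; push_cast
        exact mul_lt_mul_of_pos_left (by exact_mod_cast (by omega : k < A.q n)) (by exact_mod_cast hp)
      have hyp : (A.pos (n + 1) y : ℤ) = A.p n * k := by
        have := (A.col_zpow Φ hΦ (n + 1) x z (by rw [hzdef]; ring_nf; positivity)
          (by rw [hzdef]; linarith)).2
        rw [hy, this, hzdef]; ring
      have hyp' : A.pos (n + 1) y = A.p n * k := by exact_mod_cast hyp
      have hn0 : A.pos n y = 0 := by rw [A.pos_link, hyp', Nat.mul_mod_right]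
      have hn0' : A.pos n y' = 0 := by rw [← (hz z).2]; exact hn0
      set j := A.pos (n + 1) y' / A.p n with hj
      have hj1 : A.pos (n + 1) y' = A.p n * j := by
        have := Nat.div_add_mod (A.pos (n + 1) y') (A.p n)
        rw [← A.pos_link, hn0', add_zero] at this
        exact this.symm
      have hj1' : (A.pos (n + 1) y' : ℤ) = A.p n * j := by exact_mod_cast hj1
      have hjq : j < A.q n := by
        have := A.pos_lt (n + 1) y'
        rw [A.hpq] at this
        exact Nat.div_lt_of_lt_mul this
      have hw : ∀ z' : ℤ, ∀ l l' : ℕ, (l : ℤ) = k + z' → (l' : ℤ) = j + z' → l < A.q n → l' < A.q n →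
          A.w n (A.col (n + 1) y') l' = A.w n (A.col (n + 1) y) l := by
        intro z' l l' h1 h2 h3 h4
        rw [← A.col_word Φ hΦ n y' (A.p n * z') l' h4 (by rw [hj1', h2]; ring),
          ← A.col_word Φ hΦ n y (A.p n * z') l h3 (by rw [hyp, h1]; ring), hzy]
      have hd := hk3 (A.col (n + 1) y)
      have hjk : j = k := by
        refine hk4 (A.col (n + 1) y') j hjq ?_ ?_ ?_ ?_
        · rw [hw 0 k j (by simp) (by simp) (by omega) hjq, hd.2.1]
        · intro h1; rw [hw (-1) (k - 1) (j - 1) (by omega) (by omega) (by omega) (by omega), hd.1]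
        · intro h1; rw [hw 1 (k + 1) (j + 1) (by omega) (by omega) (by omega) (by omega), hd.2.2.1]
        · intro h1; rw [hw 2 (k + 2) (j + 2) (by omega) (by omega) (by omega) (by omega), hd.2.2.2]
      have hyy : A.pos (n + 1) y = A.pos (n + 1) y' := by rw [hyp', hj1, hjk]
      have e1 := A.pos_zpow Φ hΦ (n + 1) y (-z)
      have e2 := A.pos_zpow Φ hΦ (n + 1) y' (-z)
      rw [← hyy, ← e1, hy, hy', ← Equiv.Perm.mul_apply, ← Equiv.Perm.mul_apply, ← zpow_add] at e2
      simp at e2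
      exact e2.symm
    refine ⟨?_, hpos⟩
    obtain ⟨h1, h2, h3⟩ := he (A.col (n + 1) x)
    refine h3 _ ?_
    rw [← A.col_word Φ hΦ n x' (A.p n * e (A.col (n + 1) x) - A.pos (n + 1) x') _ h1 (by ring),
      ← hpos, ← (hz _).1, A.col_word Φ hΦ n x _ _ h1 (by ring), h2]

theorem code_inj (hΦ : ∀ x n, A.Succ n x (Φ x))
    (x x' : X) (h : ∀ z : ℤ, A.col 0 ((Φ ^ z) x) = A.col 0 ((Φ ^ z) x')) : x = x' :=
  A.sep x x' fun n => A.code_inj_aux Φ hΦ n x x' h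

theorem exists_base [CompactSpace X] [Nonempty X] : ∃ x, ∀ n, A.pos n x = 0 := by
  obtain ⟨x0⟩ := ‹Nonempty X›
  have hc : ∀ n, IsClosed {x | A.pos n x = 0} := fun n => (clopen_pred (A.lc_pos n) (fun z => z = 0)).1
  obtain ⟨x, hx⟩ := IsCompact.nonempty_iInter_of_sequence_nonempty_isCompact_isClosed
    (fun n => {x | A.pos n x = 0})
    (fun n x hx => by
      have hx' : A.pos (n + 1) x = 0 := hx
      show A.pos n x = 0
      rw [A.pos_link, hx', Nat.zero_mod])
    (fun n => by
      obtain ⟨y, -, h⟩ := A.full n x0 0 (A.hp n)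
      exact ⟨y, h⟩)
    (hc 0).isCompact hc
  exact ⟨x, fun n => mem_iInter.1 hx n⟩

theorem p_gt (n : ℕ) : n < A.p n := by
  induction n with
  | zero => exact A.hp 0
  | succ n ih =>
    rw [A.hpq]
    calc n + 1 < A.p n * 2 := by omega
      _ ≤ _ := Nat.mul_le_mul_left _ (A.hq n)

theorem col_det (n : ℕ) (y y' : X) (h1 : A.col n y = A.col n y') (h2 : A.pos n y = A.pos n y') :
    A.col 0 y = A.col 0 y' := by
  induction n with
  | zero => exact h1
  | succ n ih =>
    refine ih ?_ ?_
    · rw [A.col_link n y, A.col_link n y', h1, h2]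
    · rw [A.pos_link n y, A.pos_link n y', h2]

theorem quasi (hΦ : ∀ x n, A.Succ n x (Φ x))
    (x : X) (hx : ∀ n, A.pos n x = 0) (m : ℤ) :
    ∃ P : ℤ, P ≠ 0 ∧ ∀ n : ℤ, A.col 0 ((Φ ^ m) x) = A.col 0 ((Φ ^ (m + n * P)) x) := by
  set N := m.natAbs with hN
  have hp := A.hp N
  have hpN := A.p_gt N
  have hp1 := A.hp (N + 1)
  refine ⟨A.p (N + 1), by exact_mod_cast hp1.ne', fun n => ?_⟩
  have hpos : ∀ n : ℤ, (A.pos (N + 1) ((Φ ^ (m + n * A.p (N + 1))) x) : ℤ) = m % A.p (N + 1) := by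
    intro n
    rw [A.pos_zpow Φ hΦ, hx, Nat.cast_zero, zero_add, Int.add_mul_emod_self_right]
  have hcol : ∀ n : ℤ, A.col N ((Φ ^ (m + n * A.p (N + 1))) x) = A.c0 N := by
    intro n
    have h1 := hpos n
    have hq := A.hq N
    have hpq := A.hpq N
    rw [A.col_link]
    rcases le_or_gt 0 m with hm | hm
    · have h2 : A.p N ≤ A.p (N + 1) := by rw [hpq]; exact Nat.le_mul_of_pos_right _ (by omega)
      rw [Int.emod_eq_of_lt hm (by omega)] at h1
      rw [Nat.div_eq_of_lt (by omega), A.w0]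
    · have h4 : A.p N * (A.q N - 1) + A.p N = A.p (N + 1) := by
        rw [hpq]
        obtain ⟨b, hb⟩ : ∃ b, A.q N = b + 1 := ⟨A.q N - 1, by omega⟩
        rw [hb]; simp; ring
      have h5 : m % A.p (N + 1) = m + A.p (N + 1) := by
        rw [← Int.add_emod_right, Int.emod_eq_of_lt (by omega) (by omega)]
      rw [h5] at h1
      have h6 : A.pos (N + 1) ((Φ ^ (m + n * A.p (N + 1))) x) = (A.p N - N) + A.p N * (A.q N - 1) := by
        omega
      rw [h6, Nat.add_mul_div_left _ _ hp, Nat.div_eq_of_lt (by omega), zero_add, A.wl]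
  have e : (Φ ^ m) x = (Φ ^ (m + 0 * A.p (N + 1))) x := by simp
  rw [e]
  refine A.col_det N _ _ ?_ ?_
  · rw [hcol, hcol]
  · rw [A.pos_link, A.pos_link N ((Φ ^ (m + n * _)) x)]
    have : A.pos (N + 1) ((Φ ^ (m + 0 * A.p (N + 1) : ℤ)) x) = A.pos (N + 1) ((Φ ^ (m + n * A.p (N + 1))) x) := by
      have := (hpos 0).trans (hpos n).symm
      exact_mod_cast this
    rw [this]

theorem not_per (hΦ : ∀ x n, A.Succ n x (Φ x))
    (x : X) (hx : ∀ n, A.pos n x = 0) (P : ℤ)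
    (h : ∀ m : ℤ, A.col 0 ((Φ ^ (m + P)) x) = A.col 0 ((Φ ^ m) x)) : P = 0 := by
  have h1 : (Φ ^ P) x = x := by
    refine A.code_inj Φ hΦ _ _ fun z => ?_
    rw [← Equiv.Perm.mul_apply, ← zpow_add, h]
  have h2 := A.pos_zpow Φ hΦ P.natAbs x P
  rw [h1, hx, Nat.cast_zero, zero_add] at h2
  have h3 := Int.dvd_of_emod_eq_zero h2.symm
  have h4 := A.p_gt P.natAbs
  exact Int.eq_zero_of_abs_lt_dvd h3 (by rw [Int.abs_eq_natAbs]; exact_mod_cast h4)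

theorem birk (hΦ : ∀ x n, A.Succ n x (Φ x))
    (f : X → ℤ) (n : ℕ) (fv : Fin (A.s n) → ℕ → ℤ) (hf : ∀ x, f x = fv (A.col n x) (A.pos n x))
    (x : X) (hx : A.pos n x = 0) :
    ∑ j ∈ Finset.range (A.p n), f ((Φ ^ j) x) = ∑ j ∈ Finset.range (A.p n), fv (A.col n x) j := by
  refine Finset.sum_congr rfl fun j hj => ?_
  have := A.col_pow Φ hΦ n x j (by rw [hx, zero_add]; exact Finset.mem_range.1 hj)
  rw [hf, this.1, this.2, hx, zero_add]

end Tower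
end ToeplitzProof

namespace ToeplitzProof
section
variable {X I : Type*} [TopologicalSpace X] {ev : Set X → I → ℝ}

open Classical in
/-- integer combinations of indicators of clopen sets -/
noncomputable def comb (l : List (TopologicalSpace.Clopens X × ℤ)) (x : X) : ℤ :=
  (l.map (fun c => if x ∈ c.1 then c.2 else 0)).sum

theorem comb_lc (l : List (TopologicalSpace.Clopens X × ℤ)) : IsLocallyConstant (comb l) := by
  classical
  induction l with
  | nil => exact IsLocallyConstant.const 0
  | cons c l ih =>
    have h : comb (c :: l) = (fun x => if x ∈ c.1 then c.2 else 0) + comb l := by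
      funext x; simp [comb]
    rw [h]
    refine IsLocallyConstant.add ?_ ih
    have h1 : IsLocallyConstant (fun x : X => decide (x ∈ c.1)) := by
      rw [IsLocallyConstant.iff_exists_open]
      intro x
      by_cases hx : x ∈ c.1
      · exact ⟨c.1, c.1.isClopen.2, hx, fun y hy => by
          have : y ∈ c.1 := hy
          simp [hx, this]⟩
      · exact ⟨(c.1 : Set X)ᶜ, c.1.isClopen.compl.2, hx, fun y hy => by
          have : y ∉ c.1 := hy
          simp [hx, this]⟩
    have := h1.comp (fun b : Bool => if b = true then c.2 else 0)
    convert this using 1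
    funext x; simp

theorem EvSys.tower (S : EvSys ev) [CompactSpace X] [T2Space X] [TotallyDisconnectedSpace X]
    [Countable (TopologicalSpace.Clopens X)] (J : (X → ℤ) → I → ℝ)
    (hJ : ∀ (ι : Type) (_ : Fintype ι) (t : X → ι), IsLocallyConstant t → ∀ (fv : ι → ℤ) (i : I),
      J (fun x => fv (t x)) i = ∑ j, (fv j : ℝ) * ev {x | t x = j} i) :
    ∃ A : Tower X, (∃ ι : Fin (A.s 0) → Fin 2, Function.Injective ι) ∧
      (∀ n c i j, i < A.p n → j < A.p n →
        ev {x | A.col n x = c ∧ A.pos n x = i} = ev {x | A.col n x = c ∧ A.pos n x = j}) ∧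
      ∀ l, ∃ (n : ℕ) (fv : Fin (A.s n) → ℕ → ℤ), (∀ x, comb l x = fv (A.col n x) (A.pos n x)) ∧
        ((∀ i, 0 < J (comb l) i) → ∀ d, 0 ≤ ∑ j ∈ Finset.range (A.p n), fv d j) := by
  classical
  obtain ⟨en, hen⟩ := exists_surjective_nat (List (TopologicalSpace.Clopens X × ℤ))
  obtain ⟨A0, h0, h0'⟩ := S.base
  choose B q w c0 hlink using fun (A : Stage ev) (l : List (TopologicalSpace.Clopens X × ℤ)) =>
    S.step J hJ A (comb l) (comb_lc l)
  let st : ℕ → Stage ev := fun n => Nat.rec A0 (fun n A => B A (en n)) n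
  have L : ∀ n, Link J (st n) (st (n + 1)) (comb (en n)) (q (st n) (en n)) (w (st n) (en n))
      (c0 (st n) (en n)) := fun n => hlink (st n) (en n)
  have hfull : ∀ n x j, j < (st n).p → ∃ y, (st n).col y = (st n).col x ∧ (st n).pos y = j := by
    intro n x j hj
    by_contra hcon
    have h1 : {y | (st n).col y = (st n).col x ∧ (st n).pos y = j} = ∅ := by
      ext y; simp only [mem_ofPred_eq, mem_empty_iff_false, iff_false]; exact fun h => hcon ⟨y, h⟩
    have h2 := (st n).eqm ((st n).col x) j ((st n).pos x) hj ((st n).pos_lt x)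
    obtain ⟨i0⟩ := S.ne
    have h3 := S.pos {y | (st n).col y = (st n).col x ∧ (st n).pos y = (st n).pos x}
      (clopen_pred ((st n).lc_col.prodMk (st n).lc_pos) (fun z => z.1 = (st n).col x ∧ z.2 = (st n).pos x))
      ⟨x, rfl, rfl⟩ i0
    rw [← h2, h1, S.empty] at h3
    simp at h3
  have hval : ∀ l, ∃ (n : ℕ) (fv : Fin ((st n).s) → ℕ → ℤ),
      (∀ x, comb l x = fv ((st n).col x) ((st n).pos x)) ∧
        ((∀ i, 0 < J (comb l) i) → ∀ d, 0 ≤ ∑ j ∈ Finset.range ((st n).p), fv d j) := by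
    intro l
    obtain ⟨n, rfl⟩ := hen l
    obtain ⟨-, -, -, -, -, -, fv, h1, h2⟩ := L n
    exact ⟨n + 1, fv, h1, h2⟩
  refine ⟨{ s := fun n => (st n).s
            p := fun n => (st n).p
            q := fun n => q (st n) (en n)
            col := fun n => (st n).col
            pos := fun n => (st n).pos
            w := fun n => w (st n) (en n)
            c0 := fun n => c0 (st n) (en n)
            hp0 := h0'
            hp := fun n => (st n).hp
            hq := fun n => (L n).1
            hpq := fun n => (L n).2.1
            pos_lt := fun n => (st n).pos_lt
            lc_col := fun n => (st n).lc_col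
            lc_pos := fun n => (st n).lc_pos
            pos_link := fun n => (L n).2.2.1
            col_link := fun n => (L n).2.2.2.1
            w0 := fun n d => ((L n).2.2.2.2.1 d).1
            wl := fun n d => ((L n).2.2.2.2.1 d).2
            recog := fun n => (L n).2.2.2.2.2.1
            full := hfull
            sep := ?_ }, ⟨Fin.cast h0, Fin.cast_injective h0⟩, fun n => (st n).eqm, hval⟩
  intro x y h
  by_contra hne
  obtain ⟨U, hU, hxU, hyU⟩ := exists_isClopen_of_totally_separated hne
  obtain ⟨n, fv, h1, -⟩ := hval [(⟨U, hU⟩, 1)]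
  have h2 := h1 x
  have h3 := h1 y
  rw [(h n).1, (h n).2, ← h3] at h2
  have a1 : x ∈ (⟨U, hU⟩ : TopologicalSpace.Clopens X) := hxU
  have a2 : y ∉ (⟨U, hU⟩ : TopologicalSpace.Clopens X) := hyU
  simp [comb, a1, a2] at h2
end
end ToeplitzProof

namespace ToeplitzProof
section
variable {X I : Type*} [TopologicalSpace X] {ev : Set X → I → ℝ}

/-- column and position, bundled -/
def Tower.cp (A : Tower X) (n : ℕ) (x : X) : Fin (A.s n) × Fin (A.p n) :=
  (A.col n x, ⟨A.pos n x, A.pos_lt n x⟩)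

theorem Tower.cp_lc (A : Tower X) (n : ℕ) : IsLocallyConstant (A.cp n) := by
  have h1 := (A.lc_col n).prodMk (A.lc_pos n)
  have := h1.comp (fun y : Fin (A.s n) × ℕ => (y.1, (⟨y.2 % A.p n, Nat.mod_lt _ (A.hp n)⟩ : Fin (A.p n))))
  convert this using 1
  funext x
  simp [Tower.cp, Nat.mod_eq_of_lt (A.pos_lt n x)]

theorem Tower.cp_set (A : Tower X) (n : ℕ) (c : Fin (A.s n)) (i : Fin (A.p n)) :
    {x | A.cp n x = (c, i)} = {x | A.col n x = c ∧ A.pos n x = i} := by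
  ext x; simp [Tower.cp, Prod.ext_iff, Fin.ext_iff]

open Classical in
theorem EvSys.ev_level (S : EvSys ev) (A : Tower X) (n : ℕ)
    (eqm : ∀ c i j, i < A.p n → j < A.p n →
        ev {x | A.col n x = c ∧ A.pos n x = i} = ev {x | A.col n x = c ∧ A.pos n x = j})
    (R : Fin (A.s n) → ℕ → Prop) :
    ev {x | R (A.col n x) (A.pos n x)} = ∑ c, ∑ i ∈ Finset.range (A.p n),
      if R c i then ev {x | A.col n x = c ∧ A.pos n x = 0} else 0 := by
  have h := S.fiber_sum (A.cp_lc n) (fun y => R y.1 y.2)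
  have h1 : {x | R (A.cp n x).1 (A.cp n x).2} = {x | R (A.col n x) (A.pos n x)} := rfl
  rw [h1] at h
  rw [h, Finset.sum_filter, Fintype.sum_prod_type]
  refine Finset.sum_congr rfl fun c _ => ?_
  rw [← Fin.sum_univ_eq_sum_range (fun i => if R c i then ev {x | A.col n x = c ∧ A.pos n x = 0} else 0)]
  refine Finset.sum_congr rfl fun i _ => ?_
  simp only
  rw [A.cp_set, eqm c i 0 i.2 (A.hp n)]

theorem ite_iff {α : Type*} {P Q : Prop} {iP : Decidable P} {iQ : Decidable Q} (h : P ↔ Q) (a b : α) :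
    (if P then a else b) = if Q then a else b := by
  by_cases hq : Q
  · rw [if_pos hq, if_pos (h.2 hq)]
  · rw [if_neg hq, if_neg (fun hp => hq (h.1 hp))]

theorem EvSys.inv_level (S : EvSys ev) (A : Tower X) (n : ℕ)
    (eqm : ∀ c i j, i < A.p n → j < A.p n →
        ev {x | A.col n x = c ∧ A.pos n x = i} = ev {x | A.col n x = c ∧ A.pos n x = j})
    (φ : X → X) (hφ : ∀ x, A.Succ n x (φ x))
    (R : Fin (A.s n) → ℕ → Prop) (P0 : Prop) (hR : ∀ c, R c 0 ↔ P0) :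
    ev (φ ⁻¹' {x | R (A.col n x) (A.pos n x)}) = ev {x | R (A.col n x) (A.pos n x)} := by
  classical
  have h1 : φ ⁻¹' {x | R (A.col n x) (A.pos n x)} = {x | (fun c i => (i + 1 < A.p n ∧ R c (i + 1)) ∨
      (i + 1 = A.p n ∧ P0)) (A.col n x) (A.pos n x)} := by
    ext x
    simp only [mem_preimage, mem_ofPred_eq]
    have hlt := A.pos_lt n x
    rcases Nat.lt_or_ge (A.pos n x + 1) (A.p n) with h | h
    · obtain ⟨h2, h3⟩ := (hφ x).1 h
      rw [h2, h3]
      constructor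
      · intro h4; exact Or.inl ⟨h, h4⟩
      · rintro (h4 | h4)
        · exact h4.2
        · omega
    · have h' : A.pos n x + 1 = A.p n := by omega
      rw [(hφ x).2 h', hR]
      constructor
      · intro h4; exact Or.inr ⟨h', h4⟩
      · rintro (h4 | h4)
        · omega
        · exact h4.2
  rw [h1, S.ev_level A n eqm (fun c i => (i + 1 < A.p n ∧ R c (i + 1)) ∨ (i + 1 = A.p n ∧ P0)),
    S.ev_level A n eqm R]
  refine Finset.sum_congr rfl fun c _ => ?_
  obtain ⟨m, hm⟩ : ∃ m, A.p n = m + 1 := ⟨A.p n - 1, by have := A.hp n; omega⟩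
  rw [hm, Finset.sum_range_succ, Finset.sum_range_succ' (fun i => if R c i then _ else _)]
  congr 1
  · refine Finset.sum_congr rfl fun i hi => ?_
    have := Finset.mem_range.1 hi
    refine ite_iff ?_ _ _
    constructor
    · rintro (h | h)
      · exact h.2
      · omega
    · intro h; exact Or.inl ⟨by omega, h⟩
  · refine ite_iff ?_ _ _
    rw [hR]
    constructor
    · rintro (h | h)
      · omega
      · exact h.2
    · intro h; exact Or.inr ⟨rfl, h⟩

theorem EvSys.inv (S : EvSys ev) (A : Tower X)
    (eqm : ∀ n c i j, i < A.p n → j < A.p n →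
        ev {x | A.col n x = c ∧ A.pos n x = i} = ev {x | A.col n x = c ∧ A.pos n x = j})
    (φ : X → X) (hφ : ∀ x n, A.Succ n x (φ x)) (n : ℕ)
    (R : Fin (A.s n) → ℕ → Prop) :
    ev (φ ⁻¹' {x | R (A.col n x) (A.pos n x)}) = ev {x | R (A.col n x) (A.pos n x)} := by
  have h : {x | R (A.col n x) (A.pos n x)} = {x | (fun d j => R (A.w n d (j / A.p n)) (j % A.p n))
      (A.col (n + 1) x) (A.pos (n + 1) x)} := by
    ext x
    simp only [mem_ofPred_eq]
    rw [A.col_link n x, A.pos_link n x]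
  rw [h]
  exact S.inv_level A (n + 1) (eqm (n + 1)) φ (fun x => hφ x (n + 1))
    (fun d j => R (A.w n d (j / A.p n)) (j % A.p n)) (R (A.c0 n) 0)
    (fun d => by simp only [Nat.zero_div, Nat.zero_mod, A.w0])
end
end ToeplitzProof

namespace ToeplitzProof
section
variable {X : Type*} [TopologicalSpace X] [MeasurableSpace X] [BorelSpace X]

theorem integral_lc (μ : Measure X) [IsProbabilityMeasure μ] {ι : Type} [Fintype ι] (t : X → ι)
    (ht : IsLocallyConstant t) (fv : ι → ℤ) :
    ∫ x, (fv (t x) : ℝ) ∂μ = ∑ j, (fv j : ℝ) * μ.real {x | t x = j} := by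
  classical
  have h : ∀ x, (fv (t x) : ℝ) = ∑ j, ({x | t x = j} : Set X).indicator (fun _ => (fv j : ℝ)) x := by
    intro x
    rw [Finset.sum_eq_single (t x)]
    · simp
    · intro b _ hb
      simp [Ne.symm hb]
    · simp
  have hm : ∀ j, MeasurableSet {x | t x = j} := fun j => (ht.isClopen_fiber j).isOpen.measurableSet
  simp_rw [h]
  rw [integral_finsetSum _ (fun j _ => (integrable_const (fv j : ℝ)).indicator (hm j))]
  refine Finset.sum_congr rfl fun j _ => ?_
  rw [integral_indicator_const _ (hm j), smul_eq_mul, mul_comm]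

theorem integrable_comb (μ : Measure X) [IsProbabilityMeasure μ]
    (l : List (TopologicalSpace.Clopens X × ℤ)) : Integrable (fun x => (comb l x : ℝ)) μ := by
  classical
  induction l with
  | nil => simp [comb]
  | cons c l ih =>
    have h : (fun x => (comb (c :: l) x : ℝ)) =
        fun x => (c.1 : Set X).indicator (fun _ => (c.2 : ℝ)) x + (comb l x : ℝ) := by
      funext x
      simp only [comb, List.map_cons, List.sum_cons, Int.cast_add, indicator]
      simp
    rw [h]
    exact ((integrable_const _).indicator c.1.isClopen.isOpen.measurableSet).add ih

theorem integral_comb (μ : Measure X) [IsProbabilityMeasure μ]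
    (l : List (TopologicalSpace.Clopens X × ℤ)) :
    ∫ x, (comb l x : ℝ) ∂μ = (l.map (fun c => (c.2 : ℝ) * μ.real c.1)).sum := by
  classical
  induction l with
  | nil => simp [comb]
  | cons c l ih =>
    have h : (fun x => (comb (c :: l) x : ℝ)) =
        fun x => (c.1 : Set X).indicator (fun _ => (c.2 : ℝ)) x + (comb l x : ℝ) := by
      funext x
      simp only [comb, List.map_cons, List.sum_cons, Int.cast_add, indicator]
      simp
    have hm := c.1.isClopen.isOpen.measurableSet
    rw [h, integral_add ((integrable_const _).indicator hm) (integrable_comb μ l), ih,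
      integral_indicator_const _ hm, List.map_cons, List.sum_cons, smul_eq_mul, mul_comm]

theorem continuous_real [HasOuterApproxClosed X] (U : Set X) (hU : IsClopen U) :
    Continuous (fun μ : ProbabilityMeasure X => (μ : Measure X).real U) := by
  rw [continuous_iff_continuousAt]
  intro μ
  have h := ProbabilityMeasure.tendsto_measure_of_null_frontier_of_tendsto' (μ := μ)
    (μs := fun ν => ν) (L := nhds μ) Filter.tendsto_id (E := U) (by simp [hU.frontier_eq])
  exact (ENNReal.tendsto_toReal (measure_ne_top _ _)).comp h

/-- evaluation of the members of `K` -/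
noncomputable def evK (K : Set (ProbabilityMeasure X)) (U : Set X) (μ : K) : ℝ :=
  ((μ.1 : ProbabilityMeasure X) : Measure X).real U

theorem measure_eq_of_clopen [CompactSpace X] [T2Space X] [TotallyDisconnectedSpace X]
    [SecondCountableTopology X] (μ ν : Measure X) [IsProbabilityMeasure μ] [IsProbabilityMeasure ν]
    (h : ∀ U : Set X, IsClopen U → μ U = ν U) : μ = ν := by
  refine ext_of_generate_finite {U : Set X | IsClopen U} ?_ ?_ (fun U hU => h U hU) (by simp)
  · rw [BorelSpace.measurable_eq (α := X)]
    exact (isTopologicalBasis_isClopen (X := X)).borel_eq_generateFrom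
  · intro U hU V hV _
    exact IsClopen.inter hU hV

theorem evK_cont [HasOuterApproxClosed X] (K : Set (ProbabilityMeasure X)) (g : K → ℝ)
    (hg : g ∈ EE (evK K)) : Continuous g := by
  induction hg using Submodule.span_induction with
  | mem g h =>
    obtain ⟨U, hU, rfl⟩ := h
    exact (continuous_real U hU).comp continuous_subtype_val
  | zero => exact continuous_const
  | add g h _ _ hg hh => exact hg.add hh
  | smul a g _ hg => exact hg.const_smul a

end
end ToeplitzProof

namespace ToeplitzProof
section
variable {X : Type*} [TopologicalSpace X] [MeasurableSpace X] [BorelSpace X]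

theorem evSysK [HasOuterApproxClosed X] (K : Set (ProbabilityMeasure X)) (hK : IsDynSimplex K)
    (hdiv : Divisible K) : EvSys (evK K) := by
  obtain ⟨hne, hcpt, hconv, hna, hpos, hgw⟩ := hK
  have hne' : Nonempty K := hne.to_subtype
  refine ⟨?_, ?_, ?_, ?_, ?_, ?_, hne'⟩
  · intro U V hU hV hd
    funext μ
    exact measureReal_union hd hV.isOpen.measurableSet
  · funext μ
    simp [evK]
  · intro U hU hn μ
    have := hpos μ.1 μ.2
    exact ENNReal.toReal_pos (hU.isOpen.measure_pos _ hn).ne' (measure_ne_top _ _)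
  · intro U V hU hV h
    obtain ⟨W, hW, hWV, hWU⟩ := hgw U V hU hV (fun μ hμ =>
      (ENNReal.toReal_lt_toReal (measure_ne_top _ _) (measure_ne_top _ _)).1 (h ⟨μ, hμ⟩))
    refine ⟨W, hW, hWV, ?_⟩
    funext μ
    exact congrArg ENNReal.toReal (hWU μ.1 μ.2)
  · intro U hU n hn
    obtain ⟨V, hV, hVU, h⟩ := hdiv U hU n hn
    refine ⟨V, hV, hVU, fun μ => ?_⟩
    have := congrArg ENNReal.toReal (h μ.1 μ.2)
    rw [ENNReal.toReal_div, ENNReal.toReal_natCast] at this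
    exact this
  · intro g hg hgp
    have hc := evK_cont K g hg
    have : CompactSpace K := isCompact_iff_compactSpace.1 hcpt
    obtain ⟨m, -, hm⟩ := isCompact_univ.exists_isMinOn (s := (Set.univ : Set K)) univ_nonempty hc.continuousOn
    obtain ⟨N, hN⟩ := exists_nat_gt (1 / g m)
    refine ⟨N + 1, Nat.succ_pos _, fun i => ?_⟩
    have h1 : g m ≤ g i := hm (mem_univ i)
    have h2 := hgp m
    rw [div_lt_iff₀ h2] at hN
    push_cast
    nlinarith [Nat.cast_nonneg (α := ℝ) N]

theorem hJK (K : Set (ProbabilityMeasure X)) : ∀ (ι : Type) (_ : Fintype ι) (t : X → ι),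
    IsLocallyConstant t → ∀ (fv : ι → ℤ) (i : K),
      (fun (f : X → ℤ) (μ : K) => ∫ x, (f x : ℝ) ∂((μ.1 : ProbabilityMeasure X) : Measure X))
        (fun x => fv (t x)) i = ∑ j, (fv j : ℝ) * evK K {x | t x = j} i :=
  fun _ _ t ht fv i => integral_lc _ t ht fv

/-- an invariant measure integrates tower functions with nonnegative column sums nonnegatively -/
theorem inv_integral_nonneg (A : Tower X) (φ : X ≃ₜ X) (hφ : ∀ x n, A.Succ n x (φ x))
    (μ : Measure X) [IsProbabilityMeasure μ] (hμ : μ.map φ = μ) (n : ℕ)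
    (fv : Fin (A.s n) → ℕ → ℤ) (h : ∀ d, 0 ≤ ∑ j ∈ Finset.range (A.p n), fv d j) :
    0 ≤ ∫ x, (fv (A.col n x) (A.pos n x) : ℝ) ∂μ := by
  have h1 := integral_lc μ (A.cp n) (A.cp_lc n) (fun y => fv y.1 y.2)
  have h2 : ∀ x, fv (A.cp n x).1 (A.cp n x).2 = fv (A.col n x) (A.pos n x) := fun x => rfl
  simp only [h2] at h1
  rw [h1, Fintype.sum_prod_type]
  have h3 : ∀ c i, i < A.p n → μ.real {x | A.col n x = c ∧ A.pos n x = i} =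
      μ.real {x | A.col n x = c ∧ A.pos n x = 0} := by
    intro c i
    induction i with
    | zero => intro _; rfl
    | succ i ih =>
      intro hi
      rw [← ih (by omega)]
      have hcl : IsClopen {x | A.col n x = c ∧ A.pos n x = i + 1} :=
        ((A.lc_col n).isClopen_fiber c).inter ((A.lc_pos n).isClopen_fiber (i + 1))
      have h4 : φ ⁻¹' {x | A.col n x = c ∧ A.pos n x = i + 1} = {x | A.col n x = c ∧ A.pos n x = i} := by
        ext x
        simp only [mem_preimage, mem_ofPred_eq]
        have hs := hφ x n
        have hlt := A.pos_lt n x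
        rcases Nat.lt_or_ge (A.pos n x + 1) (A.p n) with h5 | h5
        · obtain ⟨h6, h7⟩ := hs.1 h5
          rw [h6, h7]; simp
        · have h6 := hs.2 (by omega)
          rw [h6]
          constructor
          · rintro ⟨_, h⟩; omega
          · rintro ⟨_, h⟩; omega
      have h5 : μ {x | A.col n x = c ∧ A.pos n x = i + 1} = μ {x | A.col n x = c ∧ A.pos n x = i} := by
        conv_lhs => rw [← hμ]
        rw [Measure.map_apply φ.continuous.measurable hcl.isOpen.measurableSet, h4]
      exact congrArg ENNReal.toReal h5
  refine Finset.sum_nonneg fun c _ => ?_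
  have h4 : ∑ i : Fin (A.p n), (fv c i : ℝ) * μ.real {x | A.cp n x = (c, i)} =
      ((∑ j ∈ Finset.range (A.p n), fv c j : ℤ) : ℝ) * μ.real {x | A.col n x = c ∧ A.pos n x = 0} := by
    rw [Int.cast_sum, Finset.sum_mul, ← Fin.sum_univ_eq_sum_range
      (fun j => (fv c j : ℝ) * μ.real {x | A.col n x = c ∧ A.pos n x = 0})]
    refine Finset.sum_congr rfl fun i _ => ?_
    rw [A.cp_set, h3 c i i.2]
  have h5 := mul_nonneg (Int.cast_nonneg (R := ℝ) (h c)) (measureReal_nonneg (μ := μ)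
    (s := {x | A.col n x = c ∧ A.pos n x = 0}))
  exact h4 ▸ h5
end
end ToeplitzProof

namespace ToeplitzProof
section
variable {X : Type*} [TopologicalSpace X] [MeasurableSpace X] [BorelSpace X]

theorem exists_finset [HasOuterApproxClosed X] [CompactSpace X] [T2Space X] [TotallyDisconnectedSpace X]
    [SecondCountableTopology X] (K : Set (ProbabilityMeasure X)) (hcpt : IsCompact K)
    (μ : ProbabilityMeasure X) (hμ : μ ∉ K) :
    ∃ s : Finset (TopologicalSpace.Clopens X), ∀ ν ∈ K,
      ¬ ∀ U ∈ s, (ν : Measure X).real U = (μ : Measure X).real U := by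
  by_contra hcon
  push Not at hcon
  obtain ⟨ν, hν, h⟩ := hcpt.inter_iInter_nonempty
    (fun U : TopologicalSpace.Clopens X => {ν : ProbabilityMeasure X |
      (ν : Measure X).real U = (μ : Measure X).real U})
    (fun U => isClosed_eq (continuous_real (X := X) (U : Set X) U.isClopen) continuous_const)
    (fun s => by
      obtain ⟨ν, hν, h⟩ := hcon s
      exact ⟨ν, hν, by simpa using h⟩)
  rw [mem_iInter] at h
  apply hμ
  have : (ν : Measure X) = (μ : Measure X) := by
    refine measure_eq_of_clopen _ _ fun U hU => ?_
    have h1 : (ν : Measure X).real U = (μ : Measure X).real U := h ⟨U, hU⟩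
    exact (measureReal_eq_measureReal_iff).1 h1
  have h2 : ν = μ := Subtype.ext this
  exact h2 ▸ hν

theorem exists_sep [HasOuterApproxClosed X] [CompactSpace X] [T2Space X] [TotallyDisconnectedSpace X]
    [SecondCountableTopology X] (K : Set (ProbabilityMeasure X)) (hK : IsDynSimplex K)
    (μ : ProbabilityMeasure X) (hμ : μ ∉ K) :
    ∃ l : List (TopologicalSpace.Clopens X × ℤ),
      (∀ ν ∈ K, 0 < ∫ x, (comb l x : ℝ) ∂(ν : Measure X)) ∧
      ∫ x, (comb l x : ℝ) ∂(μ : Measure X) < 0 := by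
  classical
  obtain ⟨hne, hcpt, hconv, hna, hpos, hgw⟩ := hK
  obtain ⟨s, hs⟩ := exists_finset K hcpt μ hμ
  let F : ProbabilityMeasure X → (s → ℝ) := fun ν U => (ν : Measure X).real U.1
  have hF : Continuous F := continuous_pi fun U => continuous_real (X := X) (U.1 : Set X) U.1.isClopen
  have hcv : Convex ℝ (F '' K) := by
    rintro _ ⟨ν, hν, rfl⟩ _ ⟨ν', hν', rfl⟩ a b ha hb hab
    obtain ⟨σ, hσ, h⟩ := hconv ν hν ν' hν' (ENNReal.ofReal a) (by
      rw [ENNReal.ofReal_le_one]; linarith)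
    refine ⟨σ, hσ, ?_⟩
    funext U
    have h1 : 1 - ENNReal.ofReal a = ENNReal.ofReal b := by
      rw [← ENNReal.ofReal_one, ← ENNReal.ofReal_sub _ ha]; congr 1; linarith
    simp only [F, Pi.add_apply, Pi.smul_apply, smul_eq_mul]
    rw [h, h1, measureReal_def, Measure.add_apply, Measure.smul_apply, Measure.smul_apply,
      smul_eq_mul, smul_eq_mul, ENNReal.toReal_add, ENNReal.toReal_mul, ENNReal.toReal_mul,
      ENNReal.toReal_ofReal ha, ENNReal.toReal_ofReal hb, measureReal_def, measureReal_def]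
    · exact ENNReal.mul_ne_top ENNReal.ofReal_ne_top (measure_ne_top _ _)
    · exact ENNReal.mul_ne_top ENNReal.ofReal_ne_top (measure_ne_top _ _)
  have hdisj : Disjoint (F '' K) {F μ} := by
    rw [disjoint_singleton_right]
    rintro ⟨ν, hν, h⟩
    exact hs ν hν fun U hU => congrFun h ⟨U, hU⟩
  obtain ⟨f, u, v, hfu, huv, hfv⟩ := geometric_hahn_banach_compact_closed hcv (hcpt.image hF)
    (convex_singleton (F μ)) isClosed_singleton hdisj
  set a : s → ℝ := fun U => f (fun j => if U = j then 1 else 0) with ha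
  have hf : ∀ y : s → ℝ, f y = ∑ U, y U * a U := by
    intro y
    have := LinearMap.pi_apply_eq_sum_univ (f : (s → ℝ) →ₗ[ℝ] ℝ) y
    simpa using this
  obtain ⟨D, hD⟩ := exists_nat_gt (2 * ((s.card : ℝ) + 1) / (v - u))
  have hvu : 0 < v - u := sub_pos.2 huv
  rw [div_lt_iff₀ hvu] at hD
  let l : List (TopologicalSpace.Clopens X × ℤ) := (⊤, ⌊(D : ℝ) * ((u + v) / 2)⌋) ::
    ((Finset.univ : Finset s).toList.map (fun U => (U.1, - ⌊(D : ℝ) * a U⌋)))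
  have hcomb : ∀ ν : ProbabilityMeasure X, ∫ x, (comb l x : ℝ) ∂(ν : Measure X) =
      (⌊(D : ℝ) * ((u + v) / 2)⌋ : ℝ) - ∑ U : s, (⌊(D : ℝ) * a U⌋ : ℝ) * F ν U := by
    intro ν
    rw [integral_comb, List.map_cons, List.sum_cons, List.map_map, sub_eq_add_neg,
      ← Finset.sum_neg_distrib, ← Finset.sum_map_toList]
    congr 1
    · simp
    · congr 1
      refine List.map_congr_left fun U _ => ?_
      simp [F]
  have hF0 : ∀ ν U, 0 ≤ F ν U := fun ν U => measureReal_nonneg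
  have hF1 : ∀ ν U, F ν U ≤ 1 := fun ν U => measureReal_le_one
  have hz1 := Int.floor_le ((D : ℝ) * ((u + v) / 2))
  have hz2 := Int.lt_floor_add_one ((D : ℝ) * ((u + v) / 2))
  refine ⟨l, fun ν hν => ?_, ?_⟩
  · rw [hcomb]
    have h1 := hfu _ (mem_image_of_mem F hν)
    rw [hf] at h1
    have h2 : ∑ U : s, (⌊(D : ℝ) * a U⌋ : ℝ) * F ν U ≤ D * ∑ U : s, F ν U * a U := by
      rw [Finset.mul_sum]
      refine Finset.sum_le_sum fun U _ => ?_
      have := mul_le_mul_of_nonneg_right (Int.floor_le ((D : ℝ) * a U)) (hF0 ν U)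
      linarith
    have h3 := mul_le_mul_of_nonneg_left h1.le (Nat.cast_nonneg (α := ℝ) D)
    have h4 : (0:ℝ) ≤ s.card := Nat.cast_nonneg _
    nlinarith
  · rw [hcomb]
    have h1 := hfv _ (mem_singleton (F μ))
    rw [hf] at h1
    have h2 : D * ∑ U : s, F μ U * a U - s.card ≤ ∑ U : s, (⌊(D : ℝ) * a U⌋ : ℝ) * F μ U := by
      have h5 : (s.card : ℝ) = ∑ U : s, (1 : ℝ) := by simp
      rw [Finset.mul_sum, h5, ← Finset.sum_sub_distrib]
      refine Finset.sum_le_sum fun U _ => ?_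
      have h6 := Int.lt_floor_add_one ((D : ℝ) * a U)
      have h7 := hF0 μ U
      have h8 := hF1 μ U
      nlinarith
    have h3 := mul_le_mul_of_nonneg_left h1.le (Nat.cast_nonneg (α := ℝ) D)
    nlinarith
end
end ToeplitzProof

namespace ToeplitzProof
section
variable {X : Type*} [TopologicalSpace X]

theorem continuous_zpow (φ : X ≃ₜ X) (z : ℤ) : Continuous ⇑((φ.toEquiv : Equiv.Perm X) ^ z) := by
  induction z using Int.induction_on with
  | zero => simpa using continuous_id
  | succ i ih =>
    rw [zpow_add_one]
    exact ih.comp φ.continuous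
  | pred i ih =>
    rw [zpow_sub_one]
    exact ih.comp φ.symm.continuous

end
end ToeplitzProof

open ToeplitzProof

theorem divisible_dynSimplex_is_invariant_measures_of_Toeplitz
    {X : Type*} [TopologicalSpace X] [CompactSpace X] [TopologicalSpace.MetrizableSpace X]
    [TotallyDisconnectedSpace X] [Nonempty X] [MeasurableSpace X] [BorelSpace X]
    (hX : Perfect (Set.univ : Set X))
    (K : Set (ProbabilityMeasure X)) (hK : IsDynSimplex K) (hdiv : Divisible K) :
    ∃ (φ : X ≃ₜ X) (y : ℤ → Fin 2) (h : X → (ℤ → Fin 2)),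
      IsToeplitz y ∧
      Continuous h ∧ Function.Injective h ∧
      Set.range h = orbitClosure y ∧
      (∀ x : X, h (φ x) = shiftBy 1 (h x)) ∧
      K = {μ : ProbabilityMeasure X | (μ : Measure X).map φ = (μ : Measure X)} := by
  classical
  let _ : MetricSpace X := TopologicalSpace.metrizableSpaceMetric X
  have hcount : Countable (TopologicalSpace.Clopens X) :=
    TopologicalSpace.Clopens.countable_iff_secondCountable.2 inferInstance
  have S := evSysK K hK hdiv
  obtain ⟨A, ⟨ι, hι⟩, eqm, hlev⟩ := S.tower
    (fun (f : X → ℤ) (μ : K) => ∫ x, (f x : ℝ) ∂((μ.1 : ProbabilityMeasure X) : Measure X)) (hJK K)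
  obtain ⟨φ, hφ⟩ := A.exists_homeo
  obtain ⟨x0, hx0⟩ := A.exists_base
  set Φ : Equiv.Perm X := φ.toEquiv with hΦdef
  have hΦ : ∀ x n, A.Succ n x (Φ x) := hφ
  have hadd : ∀ (x : X) (z w : ℤ), (Φ ^ z) ((Φ ^ w) x) = (Φ ^ (z + w)) x := by
    intro x z w; rw [zpow_add]; rfl
  let h : X → (ℤ → Fin 2) := fun x z => ι (A.col 0 ((Φ ^ z) x))
  have hcont : Continuous h := by
    refine continuous_pi fun z => ?_
    exact (((A.lc_col 0).comp ι).continuous).comp (continuous_zpow φ z)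
  have hinj : Function.Injective h := by
    intro x x' hxx
    exact A.code_inj Φ hΦ x x' fun z => hι (congrFun hxx z)
  have hshift : ∀ (x : X) (k : ℤ), h ((Φ ^ k) x) = shiftBy k (h x) := by
    intro x k
    funext z
    simp only [h, shiftBy, hadd]
  -- every nonempty clopen set meets the orbit of the base point
  have hdense : Dense {x : X | ∃ k : ℤ, x = (Φ ^ k) x0} := by
    rw [(isTopologicalBasis_isClopen (X := X)).dense_iff]
    intro U hU hne
    have hU' : IsClopen U := hU
    obtain ⟨N, hN0, hN⟩ := S.bdd (evK K U) (EE.ev_mem hU') (S.pos U hU' hne)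
    let l : List (TopologicalSpace.Clopens X × ℤ) := [(⟨U, hU'⟩, (N : ℤ)), (⊤, -1)]
    obtain ⟨n, fv, hfv, hsum⟩ := hlev l
    have hs := hsum (fun μ => by
      have h1 := hN μ
      simp only [integral_comb, l, List.map_cons, List.map_nil, List.sum_cons, List.sum_nil]
      have h2 : (((⊤ : TopologicalSpace.Clopens X) : Set X)) = Set.univ := rfl
      rw [h2, probReal_univ]
      have h3 : evK K U μ = ((μ.1 : ProbabilityMeasure X) : Measure X).real U := rfl
      rw [h3] at h1
      push_cast
      change 0 < (N : ℝ) * ((μ.1 : ProbabilityMeasure X) : Measure X).real U + (-1 * 1 + 0)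
      linarith) (A.col n x0)
    rw [← A.birk Φ hΦ (comb l) n fv hfv x0 (hx0 n)] at hs
    by_contra hcon
    have hno : ∀ k : ℤ, (Φ ^ k) x0 ∉ U := fun k hk => hcon ⟨_, hk, k, rfl⟩
    have h4 : ∑ j ∈ Finset.range (A.p n), comb l ((Φ ^ j) x0) =
        ∑ j ∈ Finset.range (A.p n), (-1 : ℤ) := by
      refine Finset.sum_congr rfl fun j _ => ?_
      have h5 := hno (j : ℤ)
      rw [zpow_natCast] at h5
      have h6 : (Φ ^ j) x0 ∉ (⟨U, hU'⟩ : TopologicalSpace.Clopens X) := h5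
      have h7 : (Φ ^ j) x0 ∈ (⊤ : TopologicalSpace.Clopens X) := trivial
      simp only [comb, l, List.map_cons, List.map_nil, List.sum_cons, List.sum_nil, if_neg h6,
        if_pos h7]
      rfl
    rw [h4] at hs
    have h8 := A.hp n
    simp at hs
    omega
  have hclosed : IsClosed (range h) := (isCompact_range hcont).isClosed
  refine ⟨φ, h x0, h, ⟨?_, ?_⟩, hcont, hinj, ?_, ?_, ?_⟩
  · intro m
    obtain ⟨P, hP, hq⟩ := A.quasi Φ hΦ x0 hx0 m
    exact ⟨P, hP, fun n => congrArg ι (hq n)⟩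
  · rintro ⟨P, hP, hq⟩
    exact hP (A.not_per Φ hΦ x0 hx0 P fun m => hι (hq m))
  · apply subset_antisymm
    · rintro _ ⟨x, rfl⟩
      have h1 : h x ∈ h '' closure {x : X | ∃ k : ℤ, x = (Φ ^ k) x0} := ⟨x, hdense x, rfl⟩
      refine closure_mono ?_ (image_closure_subset_closure_image hcont h1)
      rintro _ ⟨_, ⟨k, rfl⟩, rfl⟩
      exact ⟨k, hshift x0 k⟩
    · refine closure_minimal ?_ hclosed
      rintro _ ⟨k, rfl⟩
      exact ⟨_, hshift x0 k⟩
  · intro x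
    have := hshift x 1
    rw [zpow_one] at this
    exact this
  · ext μ
    simp only [mem_ofPred_eq]
    constructor
    · intro hμ
      have : IsProbabilityMeasure ((μ : Measure X).map φ) :=
        Measure.isProbabilityMeasure_map φ.continuous.measurable.aemeasurable
      refine measure_eq_of_clopen _ _ fun U hU => ?_
      rw [Measure.map_apply φ.continuous.measurable hU.isOpen.measurableSet]
      obtain ⟨n, fv, hfv, -⟩ := hlev [(⟨U, hU⟩, 1)]
      have hset : U = {x | (fun c i => fv c i = 1) (A.col n x) (A.pos n x)} := by
        ext x
        simp only [mem_ofPred_eq]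
        rw [← hfv]
        have h6 : x ∈ (⟨U, hU⟩ : TopologicalSpace.Clopens X) ↔ x ∈ U := Iff.rfl
        simp only [comb, List.map_cons, List.map_nil, List.sum_cons, List.sum_nil, h6]
        by_cases hx : x ∈ U <;> simp [hx]
      have h1 := congrFun (S.inv A eqm φ hφ n (fun c i => fv c i = 1)) ⟨μ, hμ⟩
      rw [← hset] at h1
      exact (measureReal_eq_measureReal_iff).1 h1
    · intro hμ
      by_contra hnot
      obtain ⟨l, hl1, hl2⟩ := exists_sep K hK μ hnot
      obtain ⟨n, fv, hfv, hsum⟩ := hlev l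
      have h1 := inv_integral_nonneg A φ hφ (μ : Measure X) hμ n fv
        (hsum fun ν => hl1 ν.1 ν.2)
      simp only [← hfv] at h1
      linarith
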